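/- Let 0 < R ≤ 1, M ≥ 0, σ > 0, T > 0, and let ρ_r be an even 2-periodic probability density. If ρ₁ and ρ₂ are two classical solutions on [0,T] × ℝ of the Fokker–Planck equation ∂_t ρ(t,x) = ∂_x(ρ(t,x) G_{ρ(t,·)}(x)) + (σ²/2) ∂²_x ρ(t,x), each 2-periodic in x with ρᵢ(t,·) a probability density on [0,1] for every t, and if ρ₁(0,·) = ρ₂(0,·), then ρ₁(t,x) = ρ₂(t,x) for all t ∈ [0,T] and x ∈ ℝ. -/

import Mathlib

open MeasureTheory Real

/-- The influence field `G_ρ(x) = ∫_{x-R}^{x+R} (x-y)(ρ(y) + M ρ_r(y)) dy`. -/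
noncomputable def G (R M : ℝ) (ρ ρr : ℝ → ℝ) (x : ℝ) : ℝ :=
  ∫ y in (x - R)..(x + R), (x - y) * (ρ y + M * ρr y)

/-- `f` is an even 2-periodic probability density. -/
def IsEvenPeriodicDensity (f : ℝ → ℝ) : Prop :=
  (∀ x, f (x + 2) = f x) ∧ (∀ x, f (-x) = f x) ∧ (∀ x, 0 ≤ f x) ∧
    (∫ x in (0:ℝ)..1, f x) = 1

/-- `ρ : (t,x) ↦ ρ(t,x)` is a classical solution on `[0,T] × ℝ` of the Fokker–Planck
equation `∂_t ρ = ∂_x (ρ G_ρ) + (σ²/2) ∂²_x ρ`. -/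
def IsClassicalSolutionOn (R M σ T : ℝ) (ρr : ℝ → ℝ) (ρ : ℝ → ℝ → ℝ) : Prop :=
  ContinuousOn (Function.uncurry ρ) (Set.Icc 0 T ×ˢ Set.univ) ∧
  (∀ t : ℝ, 0 < t → t ≤ T → ∀ x : ℝ, ContDiffAt ℝ 1 (fun s => ρ s x) t) ∧
  (∀ t : ℝ, 0 < t → t ≤ T → ContDiff ℝ 2 (ρ t)) ∧
  (∀ t : ℝ, 0 < t → t ≤ T → ∀ x : ℝ,
    deriv (fun s => ρ s x) t =
      deriv (fun y => ρ t y * G R M (ρ t) ρr y) x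
        + σ ^ 2 / 2 * deriv (deriv (ρ t)) x)

section

open Filter Set
open scoped Topology ENNReal

/-- A null set carries a bounded monotone function growing infinitely faster on its right than the
primitive of a given locally integrable density. -/
lemma exists_monotone_steep_on_null {d : ℝ → ℝ} (hd : LocallyIntegrable d volume)
    (hd1 : ∀ x, 1 ≤ d x) {N : Set ℝ} (hN : volume N = 0) :
    ∃ z : ℝ → ℝ, Monotone z ∧ (∀ x, 0 ≤ z x ∧ z x ≤ 1 / 2) ∧
      ∀ b ∈ N, ∀ n : ℕ, ∀ᶠ x in 𝓝[>] b, n * ∫ y in b..x, d y ≤ z x - z b := by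
  set μ : Measure ℝ := volume.withDensity fun x => ENNReal.ofReal (d x) with hμ
  have hloc : IsLocallyFiniteMeasure μ := by
    rw [hμ]
    refine ⟨fun x => ?_⟩
    obtain ⟨U, hU, hi⟩ := hd x
    obtain ⟨O, hOU, hO, hxO⟩ := mem_nhds_iff.1 hU
    refine ⟨O, hO.mem_nhds hxO, ?_⟩
    rw [withDensity_apply _ hO.measurableSet]
    have := (hi.mono_set hOU).hasFiniteIntegral
    rw [hasFiniteIntegral_iff_ofReal (ae_of_all _ fun x => zero_le_one.trans (hd1 x))] at this
    exact this
  have hμN : μ N = 0 := withDensity_absolutelyContinuous _ _ hN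
  have hμI : ∀ a b, a ≤ b → μ (Ioc a b) = ENNReal.ofReal (∫ y in a..b, d y) := by
    intro a b hab
    rw [hμ, withDensity_apply _ measurableSet_Ioc, intervalIntegral.integral_of_le hab,
      ofReal_integral_eq_lintegral_ofReal]
    · exact (hd.integrableOn_isCompact isCompact_Icc).mono_set Ioc_subset_Icc_self
    · exact ae_of_all _ fun x => zero_le_one.trans (hd1 x)
  obtain ⟨e, he, hes⟩ := ENNReal.exists_pos_sum_of_countable' (ε := ENNReal.ofReal (1 / 2))
    (by simp) ℕ
  have hO : ∀ j, ∃ U, U ⊇ N ∧ IsOpen U ∧ μ U < e j := fun j =>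
    N.exists_isOpen_lt_of_lt _ (by rw [hμN]; exact he j)
  choose O hON hOo hOe using hO
  set ν : Measure ℝ := Measure.sum fun j => μ.restrict (O j) with hν
  have hνu : ν univ ≤ ENNReal.ofReal (1 / 2) := by
    rw [hν, Measure.sum_apply _ MeasurableSet.univ]
    simp only [Measure.restrict_apply MeasurableSet.univ, univ_inter]
    exact (ENNReal.tsum_le_tsum fun j => (hOe j).le).trans hes.le
  have hfin : IsFiniteMeasure ν := ⟨hνu.trans_lt ENNReal.ofReal_lt_top⟩
  refine ⟨fun x => ν.real (Iic x), fun x y h => measureReal_mono (Iic_subset_Iic.2 h),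
    fun x => ⟨measureReal_nonneg, ?_⟩, fun b hb n => ?_⟩
  · exact ENNReal.toReal_le_of_le_ofReal (by norm_num) ((measure_mono (subset_univ _)).trans hνu)
  · have hnhds : (⋂ j ∈ Finset.range n, O j) ∈ 𝓝 b :=
      (Filter.biInter_finset_mem _).2 fun j _ => (hOo j).mem_nhds (hON j hb)
    obtain ⟨r, hr, hball⟩ := Metric.mem_nhds_iff.1 hnhds
    filter_upwards [Ioo_mem_nhdsGT (show b < b + r by linarith)] with x hx
    have hsub : ∀ j ∈ Finset.range n, Ioc b x ⊆ O j := by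
      intro j hj y hy
      have : y ∈ Metric.ball b r := by
        rw [Metric.mem_ball, Real.dist_eq, abs_of_pos (sub_pos.2 hy.1)]
        linarith [hy.2, hx.2]
      exact mem_iInter₂.1 (hball this) j hj
    have hle : ENNReal.ofReal (n * ∫ y in b..x, d y) ≤ ν (Ioc b x) := by
      rw [hν, Measure.sum_apply _ measurableSet_Ioc]
      refine le_trans ?_ (ENNReal.sum_le_tsum (Finset.range n))
      rw [Finset.sum_congr rfl fun j hj => by
        rw [Measure.restrict_apply measurableSet_Ioc, inter_eq_self_of_subset_left (hsub j hj),
          hμI b x hx.1.le]]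
      rw [Finset.sum_const, Finset.card_range, nsmul_eq_mul, ENNReal.ofReal_mul (by positivity),
        ENNReal.ofReal_natCast]
    have hdiff : ν.real (Iic x) - ν.real (Iic b) = ν.real (Ioc b x) := by
      rw [← Iic_union_Ioc_eq_Iic hx.1.le, measureReal_union _ measurableSet_Ioc]
      · ring
      · exact Set.disjoint_left.2 fun y hy hy' => absurd hy'.1 (not_lt.2 hy)
    rw [hdiff]
    exact (ENNReal.ofReal_le_iff_le_toReal (measure_ne_top _ _)).1 hle

/-- A confining barrier `W`: it is touched from below by parabolas at every point, and it is
infinitely convex, relative to the primitive of `d`, at the points of `N`. -/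
def IsBarrier (N : Set ℝ) (d W : ℝ → ℝ) : Prop :=
  Continuous W ∧ (∀ x, W x ≤ -|x| / 2) ∧
    ∀ a, ∃ w, |w| ≤ 2 ∧ (∀ x, W a + w * (x - a) - (x - a) ^ 2 ≤ W x) ∧
      (a ∈ N → ∀ n : ℕ, ∀ᶠ x in 𝓝[>] a,
        W a + w * (x - a) + n * ∫ y in a..x, (∫ s in a..y, d s) ≤ W x)

lemma exists_isBarrier {d : ℝ → ℝ} (hd : LocallyIntegrable d volume)
    (hd1 : ∀ x, 1 ≤ d x) {N : Set ℝ} (hN : volume N = 0) :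
    ∃ W : ℝ → ℝ, IsBarrier N d W := by
  obtain ⟨z, hz, hzb, hzN⟩ := exists_monotone_steep_on_null hd hd1 hN
  have hzi : ∀ a b, IntervalIntegrable z volume a b := fun a b => hz.intervalIntegrable
  have hdi : ∀ a b, IntervalIntegrable d volume a b := fun a b =>
    (hd.integrableOn_isCompact isCompact_uIcc).intervalIntegrable
  set Z : ℝ → ℝ := fun x => ∫ y in (0 : ℝ)..x, z y with hZ
  have hZsub : ∀ a x, Z x - Z a = ∫ y in a..x, z y := fun a x =>
    intervalIntegral.integral_interval_sub_left (hzi _ _) (hzi _ _)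
  have hconv : ∀ a x, Z a + z a * (x - a) ≤ Z x := by
    intro a x
    have h1 : (∫ _ in a..x, z a) ≤ ∫ y in a..x, z y := by
      rcases le_total a x with h | h
      · exact intervalIntegral.integral_mono_on h (by simp) (hzi _ _) fun y hy => hz hy.1
      · rw [intervalIntegral.integral_symm x a, intervalIntegral.integral_symm x a]
        exact neg_le_neg <|
          intervalIntegral.integral_mono_on h (hzi _ _) (by simp) fun y hy => hz hy.2
    rw [intervalIntegral.integral_const, smul_eq_mul, ← hZsub] at h1
    linarith
  have hZc : Continuous Z := intervalIntegral.continuous_primitive hzi 0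
  have hP0 : ∀ x : ℝ, 1 ≤ √(1 + x ^ 2) := fun x => by
    rw [Real.one_le_sqrt]; nlinarith [sq_nonneg x]
  have hP : ∀ a x : ℝ, √(1 + x ^ 2) ≤
      √(1 + a ^ 2) + a / √(1 + a ^ 2) * (x - a) + (x - a) ^ 2 / 2 := by
    intro a x
    have h1 := hP0 a
    have h2 := hP0 x
    have s1 := Real.sq_sqrt (show 0 ≤ 1 + a ^ 2 by positivity)
    have s2 := Real.sq_sqrt (show 0 ≤ 1 + x ^ 2 by positivity)
    set A := √(1 + a ^ 2)
    set X := √(1 + x ^ 2)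
    have e : A + a / A * (x - a) + (x - a) ^ 2 / 2 - X
        = ((X - A) ^ 2 + (A - 1) * (x - a) ^ 2) / (2 * A) := by
      field_simp
      nlinarith
    have : 0 ≤ ((X - A) ^ 2 + (A - 1) * (x - a) ^ 2) / (2 * A) := by
      have : 0 ≤ A - 1 := by linarith
      positivity
    linarith
  have hPa : ∀ x : ℝ, |x| ≤ √(1 + x ^ 2) := fun x => Real.abs_le_sqrt (by linarith)
  refine ⟨fun x => Z x - √(1 + x ^ 2), hZc.sub (by fun_prop), fun x => ?_, fun a => ?_⟩
  · have h1 : ‖∫ y in (0 : ℝ)..x, z y‖ ≤ 1 / 2 * |x - 0| :=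
      intervalIntegral.norm_integral_le_of_norm_le_const fun y _ => by
        rw [Real.norm_eq_abs, abs_of_nonneg (hzb y).1]; exact (hzb y).2
    have h2 := (le_abs_self _).trans h1
    rw [sub_zero] at h2
    have := hPa x
    simp only [hZ]
    linarith
  · refine ⟨z a - a / √(1 + a ^ 2), ?_, fun x => ?_, fun ha n => ?_⟩
    · have h1 : |a / √(1 + a ^ 2)| ≤ 1 := by
        rw [abs_div, abs_of_pos (zero_lt_one.trans_le (hP0 a))]
        exact (div_le_one (zero_lt_one.trans_le (hP0 a))).2 (hPa a)
      have h2 := hzb a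
      rw [abs_le] at h1 ⊢
      constructor <;> linarith
    · have h1 := hP a x
      have h2 := hconv a x
      nlinarith [sq_nonneg (x - a)]
    · have key := hzN a ha (n + 1)
      obtain ⟨u, hu, hku⟩ := mem_nhdsGT_iff_exists_Ioo_subset.1 key
      filter_upwards [Ioo_mem_nhdsGT hu] with x hx
      have hdp : Continuous fun y => ∫ s in a..y, d s := intervalIntegral.continuous_primitive hdi a
      have h1 : (∫ y in a..x, (z a + (n * (∫ s in a..y, d s) + (y - a)))) ≤ ∫ y in a..x, z y := by
        refine intervalIntegral.integral_mono_on hx.1.le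
          (Continuous.intervalIntegrable (by fun_prop) _ _) (hzi _ _) fun y hy => ?_
        rcases eq_or_lt_of_le hy.1 with rfl | hy1
        · simp
        · have h3 := hku ⟨hy1, hy.2.trans_lt hx.2⟩
          simp only [mem_ofPred_eq, Nat.cast_add, Nat.cast_one] at h3
          have h4 : (∫ _ in a..y, (1 : ℝ)) ≤ ∫ s in a..y, d s :=
            intervalIntegral.integral_mono_on hy1.le (by simp) (hdi _ _) fun s _ => hd1 s
          rw [intervalIntegral.integral_const, smul_eq_mul, mul_one] at h4
          linarith
      have hi : ∀ f : ℝ → ℝ, Continuous f → IntervalIntegrable f volume a x :=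
        fun f hf => hf.intervalIntegrable _ _
      rw [intervalIntegral.integral_add (hi _ (by fun_prop)) (hi _ (by fun_prop)),
        intervalIntegral.integral_add (hi _ (by fun_prop)) (hi _ (by fun_prop)),
        intervalIntegral.integral_const, intervalIntegral.integral_const_mul,
        intervalIntegral.integral_comp_sub_right (fun y => y), integral_id, ← hZsub,
        smul_eq_mul] at h1
      have h5 := hP a x
      nlinarith

lemma IsLocalMax.second_deriv_nonpos {h h' : ℝ → ℝ} {h'' a : ℝ} (hm : IsLocalMax h a)
    (hd : ∀ᶠ x in 𝓝 a, HasDerivAt h (h' x) x) (hd2 : HasDerivAt h' h'' a) : h'' ≤ 0 := by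
  by_contra! hpos
  have e : deriv h =ᶠ[𝓝 a] h' := hd.mono fun x hx => hx.deriv
  have hmin : IsLocalMin h a := by
    refine isLocalMin_of_deriv_deriv_pos ?_ hm.deriv_eq_zero hd.self_of_nhds.continuousAt
    rw [e.deriv_eq, hd2.deriv]
    exact hpos
  have hconst : h =ᶠ[𝓝 a] fun _ => h a := by
    filter_upwards [hm, hmin] with x h1 h2 using le_antisymm h1 h2
  have h0 : h' =ᶠ[𝓝 a] fun _ => 0 := by
    filter_upwards [hconst.eventuallyEq_nhds, hd] with x h1 h2
    rw [← h2.deriv, h1.deriv_eq, deriv_const]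
  have := hd2.deriv
  rw [h0.deriv_eq, deriv_const] at this
  exact hpos.ne this

/-- At a local maximum of `h + ε W`, the barrier can be replaced by a parabola. -/
lemma IsBarrier.touching {N : Set ℝ} {d W : ℝ → ℝ} (hW : IsBarrier N d W)
    (hd : LocallyIntegrable d volume) (hd1 : ∀ x, 1 ≤ d x) {h h' : ℝ → ℝ} {ε a : ℝ} (hε : 0 < ε)
    (hm : IsLocalMax (fun x => h x + ε * W x) a) (hh : ∀ x, HasDerivAt h (h' x) x)
    (hO : a ∈ N → (fun x => h' x - h' a) =O[𝓝[>] a] fun x => ∫ s in a..x, d s) :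
    a ∉ N ∧ ∃ w, |w| ≤ 2 ∧ h' a = -(ε * w) ∧
      ∀ x, W a + w * (x - a) - (x - a) ^ 2 ≤ W x := by
  obtain ⟨-, -, hW3⟩ := hW
  obtain ⟨w, hw, hpar, hbad⟩ := hW3 a
  have hdi : ∀ a b, IntervalIntegrable d volume a b := fun a b =>
    (hd.integrableOn_isCompact isCompact_uIcc).intervalIntegrable
  have hder : h' a = -(ε * w) := by
    have h1 : IsLocalMax (fun x => h x + ε * (w * (x - a) - (x - a) ^ 2)) a := by
      filter_upwards [hm] with x hx
      have := mul_le_mul_of_nonneg_left (hpar x) hε.le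
      simp only [sub_self] at hx ⊢
      nlinarith
    have h2 : HasDerivAt (fun x => h x + ε * (w * (x - a) - (x - a) ^ 2))
        (h' a + ε * (w * 1 - 2 * (a - a) ^ 1 * 1)) a := by
      refine (hh a).add (HasDerivAt.const_mul _ (HasDerivAt.sub ?_ ?_))
      · exact ((hasDerivAt_id a).sub_const a).const_mul w
      · exact ((hasDerivAt_id a).sub_const a).pow 2
    have := h1.hasDerivAt_eq_zero h2
    simp only [sub_self] at this
    linarith
  refine ⟨fun ha => ?_, w, hw, hder, hpar⟩
  obtain ⟨C, hC⟩ := (hO ha).bound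
  obtain ⟨n, hn⟩ := exists_nat_gt (C / ε)
  rw [div_lt_iff₀ hε] at hn
  obtain ⟨u, hu, hCu⟩ := mem_nhdsGT_iff_exists_Ioo_subset.1 hC
  have hdp : Continuous fun y => ∫ s in a..y, d s := intervalIntegral.continuous_primitive hdi a
  have hdle : ∀ y, a ≤ y → y - a ≤ ∫ s in a..y, d s := by
    intro y hy
    have h4 : (∫ _ in a..y, (1 : ℝ)) ≤ ∫ s in a..y, d s :=
      intervalIntegral.integral_mono_on hy (by simp) (hdi _ _) fun s _ => hd1 s
    rwa [intervalIntegral.integral_const, smul_eq_mul, mul_one] at h4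
  have hev : ∀ᶠ x in 𝓝[>] a, False := by
    filter_upwards [Ioo_mem_nhdsGT hu, hbad ha n, nhdsWithin_le_nhds hm] with x hx hb hmx
    set m : ℝ → ℝ := fun x => ∫ y in a..x, (∫ s in a..y, d s) with hmdef
    have hmd : ∀ x, HasDerivAt m (∫ s in a..x, d s) x := fun x =>
      intervalIntegral.integral_hasDerivAt_right (hdp.intervalIntegrable _ _)
        (hdp.stronglyMeasurableAtFilter _ _) hdp.continuousAt
    have hmpos : 0 < m x := by
      have h1 : (∫ y in a..x, (y - a)) ≤ m x :=
        intervalIntegral.integral_mono_on hx.1.le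
          (Continuous.intervalIntegrable (by fun_prop) _ _) (hdp.intervalIntegrable _ _)
          fun y hy => hdle y hy.1
      rw [intervalIntegral.integral_comp_sub_right (fun y => y), integral_id] at h1
      have := pow_pos (sub_pos.2 hx.1) 2
      nlinarith
    have hF : ∀ y, HasDerivAt (fun y => h y + C * m y - h' a * y)
        (h' y + C * (∫ s in a..y, d s) - h' a * 1) y := fun y =>
      ((hh y).add ((hmd y).const_mul C)).sub ((hasDerivAt_id y).const_mul _)
    obtain ⟨c, hc, hce⟩ := exists_hasDerivAt_eq_slope _ _ hx.1
      (fun y _ => (hF y).continuousAt.continuousWithinAt) (fun y _ => hF y)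
    have hcb := hCu ⟨hc.1, hc.2.trans hx.2⟩
    simp only [mem_ofPred_eq, Real.norm_eq_abs] at hcb
    rw [abs_of_nonneg ((sub_nonneg.2 hc.1.le).trans (hdle c hc.1.le))] at hcb
    have hnn : 0 ≤ h' c + C * (∫ s in a..c, d s) - h' a * 1 := by
      linarith [(abs_le.1 hcb).1]
    rw [hce, le_div_iff₀ (sub_pos.2 hx.1), zero_mul] at hnn
    have hma : m a = 0 := by simp [hmdef]
    rw [hma] at hnn
    have hb' := mul_le_mul_of_nonneg_left hb hε.le
    have : C * m x < n * ε * m x := mul_lt_mul_of_pos_right hn hmpos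
    rw [hder] at hnn
    nlinarith
  exact (hev.exists).elim fun _ h => h

/-- The second order consequence of a local maximum of `h + ε W`. -/
lemma IsBarrier.second_deriv_le {W : ℝ → ℝ} {h h' : ℝ → ℝ} {ε a w h'' : ℝ} (hε : 0 < ε)
    (hm : IsLocalMax (fun x => h x + ε * W x) a) (hh : ∀ x, HasDerivAt h (h' x) x)
    (hpar : ∀ x, W a + w * (x - a) - (x - a) ^ 2 ≤ W x) (h2 : HasDerivAt h' h'' a) :
    h'' ≤ 2 * ε := by
  have h1 : IsLocalMax (fun x => h x + ε * (w * (x - a) - (x - a) ^ 2)) a := by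
    filter_upwards [hm] with x hx
    have := mul_le_mul_of_nonneg_left (hpar x) hε.le
    simp only [sub_self] at hx ⊢
    nlinarith
  have h3 : ∀ x, HasDerivAt (fun x => h x + ε * (w * (x - a) - (x - a) ^ 2))
      (h' x + ε * (w * 1 - 2 * (x - a) ^ 1 * 1)) x := fun x => by
    refine (hh x).add (HasDerivAt.const_mul _ (HasDerivAt.sub ?_ ?_))
    · exact ((hasDerivAt_id x).sub_const a).const_mul w
    · exact ((hasDerivAt_id x).sub_const a).pow 2
  have h4 : HasDerivAt (fun x => h' x + ε * (w * 1 - 2 * (x - a) ^ 1 * 1))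
      (h'' + ε * (0 - 2 * 1)) a := by
    refine h2.add (HasDerivAt.const_mul _ (HasDerivAt.sub (hasDerivAt_const _ _) ?_))
    simpa using ((hasDerivAt_id a).sub_const a).const_mul 2
  have := h1.second_deriv_nonpos (Eventually.of_forall h3) h4
  linarith

/-- The separate regularity of `f` (with spatial derivative `f'`) used by the maximum principle
arguments; at points of `N` the second spatial derivative may fail to exist. -/
structure SepRegular (T : ℝ) (N : Set ℝ) (d : ℝ → ℝ) (f f' : ℝ → ℝ → ℝ) : Prop where
  cont : ContinuousOn (Function.uncurry f) (Icc 0 T ×ˢ univ)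
  time : ∀ t ∈ Ioc 0 T, ∀ x, DifferentiableAt ℝ (fun s => f s x) t
  space : ∀ t ∈ Ioc 0 T, ∀ x, HasDerivAt (f t) (f' t x) x
  space2 : ∀ t ∈ Ioc 0 T, ∀ x ∉ N, DifferentiableAt ℝ (f' t) x
  bad : ∀ t ∈ Ioc 0 T, ∀ x ∈ N,
    (fun y => f' t y - f' t x) =O[𝓝[>] x] fun y => ∫ s in x..y, d s

lemma SepRegular.neg {T : ℝ} {N : Set ℝ} {d : ℝ → ℝ} {f f' : ℝ → ℝ → ℝ}
    (h : SepRegular T N d f f') :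
    SepRegular T N d (fun t x => -f t x) (fun t x => -f' t x) where
  cont := h.cont.neg
  time t ht x := (h.time t ht x).neg
  space t ht x := (h.space t ht x).neg
  space2 t ht x hx := (h.space2 t ht x hx).neg
  bad t ht x hx := (h.bad t ht x hx).neg_left.congr_left fun y => by ring

lemma SepRegular.sub {T : ℝ} {N : Set ℝ} {d : ℝ → ℝ} {f f' g g' : ℝ → ℝ → ℝ}
    (h : SepRegular T N d f f') (k : SepRegular T N d g g') :
    SepRegular T N d (fun t x => f t x - g t x) (fun t x => f' t x - g' t x) where
  cont := h.cont.sub k.cont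
  time t ht x := (h.time t ht x).sub (k.time t ht x)
  space t ht x := (h.space t ht x).sub (k.space t ht x)
  space2 t ht x hx := (h.space2 t ht x hx).sub (k.space2 t ht x hx)
  bad t ht x hx := ((h.bad t ht x hx).sub (k.bad t ht x hx)).congr_left fun y => by ring

/-- At a maximum over `[0, τ]` attained at a positive time, the derivative is nonnegative. -/
lemma hasDerivAt_nonneg_of_max_left {u : ℝ → ℝ} {u' t τ : ℝ} (ht : 0 < t) (htτ : t ≤ τ)
    (hu : HasDerivAt u u' t) (hmax : ∀ s ∈ Icc 0 τ, u s ≤ u t) : 0 ≤ u' := by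
  have h1 := hu.hasDerivWithinAt (s := Iio t)
  rw [hasDerivWithinAt_iff_tendsto_slope' (by simp)] at h1
  refine ge_of_tendsto h1 ?_
  filter_upwards [Ioo_mem_nhdsLT ht] with s hs
  rw [slope_def_field]
  exact div_nonneg_of_nonpos (by linarith [hmax s ⟨hs.1.le, hs.2.le.trans htτ⟩])
    (by linarith [hs.2])

lemma isBigO_of_differentiableAt {d : ℝ → ℝ} (hd : LocallyIntegrable d volume)
    (hd1 : ∀ x, 1 ≤ d x) {h : ℝ → ℝ} {x : ℝ} (hh : DifferentiableAt ℝ h x) :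
    (fun y => h y - h x) =O[𝓝[>] x] fun y => ∫ s in x..y, d s := by
  have hdi : ∀ a b, IntervalIntegrable d volume a b := fun a b =>
    (hd.integrableOn_isCompact isCompact_uIcc).intervalIntegrable
  refine (hh.isBigO_sub.mono nhdsWithin_le_nhds).trans (Asymptotics.IsBigO.of_bound 1 ?_)
  filter_upwards [self_mem_nhdsWithin] with y hy
  have hy : x < y := hy
  have h4 : (∫ _ in x..y, (1 : ℝ)) ≤ ∫ s in x..y, d s :=
    intervalIntegral.integral_mono_on hy.le (by simp) (hdi _ _) fun s _ => hd1 s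
  rw [intervalIntegral.integral_const, smul_eq_mul, mul_one] at h4
  rw [Real.norm_eq_abs, Real.norm_eq_abs, one_mul, abs_of_pos (sub_pos.2 hy)]
  exact h4.trans (le_abs_self _)

lemma exists_pos_mul_lt_and {c₁ c₂ u v : ℝ} (hc₁ : 0 ≤ c₁) (hc₂ : 0 ≤ c₂) (hu : 0 < u)
    (hv : 0 < v) : ∃ ε > 0, ε * c₁ < u ∧ ε * c₂ < v := by
  refine ⟨min (u / (c₁ + 1)) (v / (c₂ + 1)), by positivity, ?_, ?_⟩
  · calc _ ≤ u / (c₁ + 1) * c₁ := by gcongr; exact min_le_left _ _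
      _ < u := by rw [div_mul_eq_mul_div, div_lt_iff₀ (by positivity)]; nlinarith
  · calc _ ≤ v / (c₂ + 1) * c₂ := by gcongr; exact min_le_right _ _
      _ < v := by rw [div_mul_eq_mul_div, div_lt_iff₀ (by positivity)]; nlinarith

set_option maxHeartbeats 1000000 in
/-- Doubling of variables: one-sided oscillation bound at a positive time. -/
lemma SepRegular.osc_le {T : ℝ} {N : Set ℝ} {d W : ℝ → ℝ} {f f' : ℝ → ℝ → ℝ}
    (hreg : SepRegular T N d f f') (hd : LocallyIntegrable d volume) (hd1 : ∀ x, 1 ≤ d x)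
    (hW : IsBarrier N d W) {D B C a ℓ τ : ℝ} (hD : 0 < D) (hB : 0 ≤ B) (ha : 0 < a)
    (hℓ : 0 < ℓ) (hτ : 0 < τ) (hτT : τ ≤ T)
    (hosc : ∀ t ∈ Icc 0 T, ∀ x y, f t x - f t y ≤ a)
    (hineq : ∀ t ∈ Ioc 0 T, ∀ x ∉ N,
      |deriv (fun s => f s x) t - D * deriv (f' t) x| ≤ B * |f' t x| + C)
    (hsmall : a / τ + 4 * B * a / ℓ + 2 * C < 8 * D * a / ℓ ^ 2) {x y : ℝ} (hyx : y < x)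
    (hxy : x - y ≤ ℓ) : f τ x - f τ y ≤ 2 * a * (x - y) / ℓ := by
  by_contra! hcon
  have hWc := hW.1
  have hWneg : ∀ x, W x ≤ 0 := fun x => (hW.2.1 x).trans (by linarith [abs_nonneg x])
  set ψ : ℝ → ℝ → ℝ := fun t r => a * (2 * (r / ℓ) - (r / ℓ) ^ 2 + (τ - t) / τ) with hψ
  have hv0 : 0 < f τ x - f τ y - ψ τ (x - y) := by
    have : ψ τ (x - y) = 2 * a * (x - y) / ℓ - a * ((x - y) / ℓ) ^ 2 := by
      simp only [hψ]; ring
    rw [this]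
    have : 0 ≤ a * ((x - y) / ℓ) ^ 2 := by positivity
    linarith
  obtain ⟨ε, hε, hε1, hε2⟩ := exists_pos_mul_lt_and
    (c₁ := -W x + -W y) (c₂ := 4 * D + 4 * B) (by linarith [hWneg x, hWneg y]) (by positivity) hv0
    (sub_pos.2 hsmall)
  set b := 2 * a / ε + |x| + |y| with hb
  set Ψ : ℝ × ℝ × ℝ → ℝ := fun p =>
    f p.1 p.2.1 - f p.1 p.2.2 - ψ p.1 (p.2.1 - p.2.2) + ε * (W p.2.1 + W p.2.2) with hΨ
  set K : Set (ℝ × ℝ × ℝ) := (Icc 0 τ ×ˢ Icc (-b) b ×ˢ Icc (-b) b) ∩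
    {p | p.2.1 - p.2.2 ∈ Icc 0 ℓ} with hK
  have hKc : IsCompact K :=
    (isCompact_Icc.prod (isCompact_Icc.prod isCompact_Icc)).inter_right
      (isClosed_Icc.preimage (by fun_prop))
  have hΨc : ContinuousOn Ψ K := by
    have h1 : ContinuousOn (fun p : ℝ × ℝ × ℝ => f p.1 p.2.1) K :=
      hreg.cont.comp (f := fun p : ℝ × ℝ × ℝ => (p.1, p.2.1)) (by fun_prop)
        fun p hp => ⟨⟨hp.1.1.1, hp.1.1.2.trans hτT⟩, trivial⟩
    have h2 : ContinuousOn (fun p : ℝ × ℝ × ℝ => f p.1 p.2.2) K :=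
      hreg.cont.comp (f := fun p : ℝ × ℝ × ℝ => (p.1, p.2.2)) (by fun_prop)
        fun p hp => ⟨⟨hp.1.1.1, hp.1.1.2.trans hτT⟩, trivial⟩
    refine ((h1.sub h2).sub (Continuous.continuousOn ?_)).add (Continuous.continuousOn ?_)
    · simp only [hψ]; fun_prop
    · fun_prop
  have hbx : |x| ≤ b := by
    have : 0 ≤ 2 * a / ε + |y| := by positivity
    linarith
  have hby : |y| ≤ b := by
    have : 0 ≤ 2 * a / ε + |x| := by positivity
    linarith
  have hmem : (τ, x, y) ∈ K :=
    ⟨⟨⟨hτ.le, le_rfl⟩, abs_le.1 hbx, abs_le.1 hby⟩, ⟨(sub_pos.2 hyx).le, hxy⟩⟩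
  obtain ⟨⟨t₀, x₀, y₀⟩, hp, hmaxK⟩ := hKc.exists_isMaxOn ⟨_, hmem⟩ hΨc
  obtain ⟨⟨ht₀, -, -⟩, hr₀⟩ := hp
  simp only [mem_ofPred_eq] at ht₀ hr₀
  have hpos : 0 < Ψ (t₀, x₀, y₀) := by
    refine lt_of_lt_of_le ?_ (hmaxK hmem)
    simp only [hΨ]
    linarith
  have hψnn : ∀ t ≤ τ, ∀ r ∈ Icc 0 ℓ, 0 ≤ ψ t r := by
    intro t ht r hr
    have h1 : 0 ≤ r / ℓ := div_nonneg hr.1 hℓ.le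
    have h2 : r / ℓ ≤ 1 := (div_le_one hℓ).2 hr.2
    have h3 : 0 ≤ (τ - t) / τ := div_nonneg (by linarith) hτ.le
    exact mul_nonneg ha.le (by nlinarith)
  have hmax : ∀ t ∈ Icc 0 τ, ∀ x y, x - y ∈ Icc 0 ℓ → Ψ (t, x, y) ≤ Ψ (t₀, x₀, y₀) := by
    intro t ht x y hr
    by_cases hin : |x| ≤ b ∧ |y| ≤ b
    · exact hmaxK ⟨⟨ht, abs_le.1 hin.1, abs_le.1 hin.2⟩, hr⟩
    · have h1 := hosc t ⟨ht.1, ht.2.trans hτT⟩ x y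
      have h2 := hψnn t ht.2 _ hr
      have h3 : W x + W y ≤ -(2 * a / ε) / 2 := by
        have := hW.2.1 x
        have := hW.2.1 y
        have := abs_nonneg x
        have := abs_nonneg y
        have : 2 * a / ε ≤ b := by rw [hb, add_assoc]; exact le_add_of_nonneg_right (by positivity)
        by_cases hx : |x| ≤ b
        · have : b < |y| := not_le.1 fun h => hin ⟨hx, h⟩
          linarith
        · linarith [not_le.1 hx]
      have h4 : ε * (W x + W y) ≤ -a := by
        refine (mul_le_mul_of_nonneg_left h3 hε.le).trans (le_of_eq ?_)
        field_simp
      simp only [hΨ] at hpos ⊢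
      linarith
  have hWW : ε * (W x₀ + W y₀) ≤ 0 :=
    mul_nonpos_of_nonneg_of_nonpos hε.le (by linarith [hWneg x₀, hWneg y₀])
  have hosc₀ := hosc t₀ ⟨ht₀.1, ht₀.2.trans hτT⟩ x₀ y₀
  have hψlt : ψ t₀ (x₀ - y₀) < a := by
    simp only [hΨ] at hpos; linarith
  have ht₀pos : 0 < t₀ := by
    refine lt_of_le_of_ne ht₀.1 fun h => ?_
    have h1 := hψnn τ le_rfl _ hr₀
    have : ψ t₀ (x₀ - y₀) = ψ τ (x₀ - y₀) + a := by
      simp only [hψ, ← h, sub_zero, sub_self, zero_div, add_zero, div_self hτ.ne']; ring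
    linarith
  have hr0 : 0 < x₀ - y₀ := by
    refine lt_of_le_of_ne hr₀.1 fun h => ?_
    have h1 := hψnn t₀ ht₀.2 _ hr₀
    have : x₀ = y₀ := by linarith
    simp only [hΨ, this] at hpos h1 hWW
    linarith
  have hrℓ : x₀ - y₀ < ℓ := by
    refine lt_of_le_of_ne hr₀.2 fun h => ?_
    have h3 : 0 ≤ (τ - t₀) / τ := div_nonneg (by linarith [ht₀.2]) hτ.le
    have : ψ t₀ (x₀ - y₀) = a + a * ((τ - t₀) / τ) := by
      simp only [hψ, h, div_self hℓ.ne']; ring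
    have := mul_nonneg ha.le h3
    linarith
  have ht : t₀ ∈ Ioc 0 T := ⟨ht₀pos, ht₀.2.trans hτT⟩
  set ψ' : ℝ → ℝ := fun r => a * (2 / ℓ - 2 * (r / ℓ) / ℓ) with hψ'
  have hψd : ∀ r, HasDerivAt (ψ t₀) (ψ' r) r := by
    intro r
    have h1 : HasDerivAt (fun r : ℝ => r / ℓ) (1 / ℓ) r := (hasDerivAt_id r).div_const ℓ
    have := (((h1.const_mul 2).sub (h1.pow 2)).add_const ((τ - t₀) / τ)).const_mul a
    exact this.congr_deriv (by simp only [hψ']; push_cast; ring)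
  have hψdd : ∀ r, HasDerivAt ψ' (-(2 * a / ℓ ^ 2)) r := by
    intro r
    have h1 : HasDerivAt (fun r : ℝ => r / ℓ) (1 / ℓ) r := (hasDerivAt_id r).div_const ℓ
    have := (((h1.const_mul 2).div_const ℓ).const_sub (2 / ℓ)).const_mul a
    exact this.congr_deriv (by ring)
  -- the maximum in `x`
  have hmx : IsLocalMax (fun x => (f t₀ x - ψ t₀ (x - y₀)) + ε * W x) x₀ := by
    have : ∀ᶠ x in 𝓝 x₀, x - y₀ ∈ Icc 0 ℓ :=
      (continuous_id.sub continuous_const).continuousAt.eventually_mem (Icc_mem_nhds hr0 hrℓ)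
    filter_upwards [this] with x hx
    have := hmax t₀ ht₀ x y₀ hx
    simp only [hΨ] at this
    linarith
  have hdx : ∀ x, HasDerivAt (fun x => f t₀ x - ψ t₀ (x - y₀)) (f' t₀ x - ψ' (x - y₀)) x :=
    fun x => (hreg.space t₀ ht x).sub ((hψd (x - y₀)).comp_sub_const x y₀)
  obtain ⟨hxN, w, hw, hwx, hparx⟩ := hW.touching hd hd1 hε hmx hdx fun hx => by
    refine ((hreg.bad t₀ ht _ hx).sub (isBigO_of_differentiableAt hd hd1
      (h := fun x => ψ' (x - y₀))
      ((hψdd (x₀ - y₀)).comp_sub_const x₀ y₀).differentiableAt)).congr_left fun z => by ring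
  -- the maximum in `y`
  have hmy : IsLocalMax (fun y => (-f t₀ y - ψ t₀ (x₀ - y)) + ε * W y) y₀ := by
    have : ∀ᶠ y in 𝓝 y₀, x₀ - y ∈ Icc 0 ℓ :=
      (continuous_const.sub continuous_id).continuousAt.eventually_mem (Icc_mem_nhds hr0 hrℓ)
    filter_upwards [this] with y hy
    have := hmax t₀ ht₀ x₀ y hy
    simp only [hΨ] at this
    linarith
  have hdy : ∀ y, HasDerivAt (fun y => -f t₀ y - ψ t₀ (x₀ - y)) (-f' t₀ y - -ψ' (x₀ - y)) y :=
    fun y => (hreg.space t₀ ht y).neg.sub ((hψd (x₀ - y)).comp_const_sub x₀ y)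
  obtain ⟨hyN, w₂, hw₂, hwy, hpary⟩ := hW.touching hd hd1 hε hmy hdy fun hy => by
    refine ((hreg.bad t₀ ht _ hy).neg_left.sub (isBigO_of_differentiableAt hd hd1
      (h := fun y => -ψ' (x₀ - y))
      ((hψdd (x₀ - y₀)).comp_const_sub x₀ y₀).neg.differentiableAt)).congr_left fun z => by ring
  -- the second order condition along the antidiagonal
  have hsec : deriv (f' t₀) x₀ - deriv (f' t₀) y₀ ≤ -(8 * a / ℓ ^ 2) + 4 * ε := by
    set H : ℝ → ℝ := fun s => f t₀ (x₀ + s) - f t₀ (y₀ - s) - ψ t₀ ((x₀ - y₀) + 2 * s)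
      + ε * (w * s - w₂ * s - 2 * s ^ 2) with hH
    have hHm : IsLocalMax H 0 := by
      have : ∀ᶠ s : ℝ in 𝓝 0, (x₀ + s) - (y₀ - s) ∈ Icc 0 ℓ := by
        refine ContinuousAt.eventually_mem (f := fun s : ℝ => (x₀ + s) - (y₀ - s))
          (by fun_prop) ?_
        simpa using Icc_mem_nhds hr0 hrℓ
      filter_upwards [this] with s hs
      have h1 := hmax t₀ ht₀ _ _ hs
      have h2 := mul_le_mul_of_nonneg_left (add_le_add (hparx (x₀ + s)) (hpary (y₀ - s))) hε.le
      simp only [hΨ] at h1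
      have e : x₀ + s - (y₀ - s) = x₀ - y₀ + 2 * s := by ring
      rw [e] at h1
      simp only [hH, add_zero, sub_zero, mul_zero]
      nlinarith
    have hid : ∀ s : ℝ, HasDerivAt (fun s : ℝ => (x₀ - y₀) + 2 * s) 2 s := fun s => by
      simpa using ((hasDerivAt_id s).const_mul 2).const_add (x₀ - y₀)
    have hHd : ∀ s, HasDerivAt H (f' t₀ (x₀ + s) - -f' t₀ (y₀ - s) - ψ' ((x₀ - y₀) + 2 * s) * 2
        + ε * (w - w₂ - 4 * s)) s := by
      intro s
      refine ((((hreg.space t₀ ht _).comp_const_add x₀ s).sub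
        ((hreg.space t₀ ht _).comp_const_sub y₀ s)).sub ((hψd _).comp s (hid s))).add
        (HasDerivAt.const_mul ε ?_)
      have := (((hasDerivAt_id s).const_mul w).sub ((hasDerivAt_id s).const_mul w₂)).sub
        (((hasDerivAt_id s).pow 2).const_mul 2)
      exact this.congr_deriv (by simp only [id]; push_cast; ring)
    have hfx : HasDerivAt (f' t₀) (deriv (f' t₀) x₀) (x₀ + 0) := by
      rw [add_zero]; exact (hreg.space2 t₀ ht _ hxN).hasDerivAt
    have hfy : HasDerivAt (f' t₀) (deriv (f' t₀) y₀) (y₀ - 0) := by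
      rw [sub_zero]; exact (hreg.space2 t₀ ht _ hyN).hasDerivAt
    have hlin : HasDerivAt (fun s : ℝ => ε * (w - w₂ - 4 * s)) (ε * (-(4 * 1))) 0 :=
      (((hasDerivAt_id (0 : ℝ)).const_mul 4).const_sub (w - w₂)).const_mul ε
    have hHdd := (((hfx.comp_const_add x₀ 0).sub (hfy.comp_const_sub y₀ 0).neg).sub
      (((hψdd _).comp 0 (hid 0)).mul_const 2)).add hlin
    have := hHm.second_deriv_nonpos (Eventually.of_forall hHd) hHdd
    have e : 8 * a / ℓ ^ 2 = 4 * (2 * a / ℓ ^ 2) := by ring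
    rw [e]
    linarith
  -- the time derivative
  have htime : 0 ≤ deriv (fun s => f s x₀) t₀ - deriv (fun s => f s y₀) t₀ + a / τ := by
    have h1 : HasDerivAt (fun t => ψ t (x₀ - y₀)) (-(a / τ)) t₀ := by
      have := ((((hasDerivAt_id t₀).const_sub τ).div_const τ).const_add
        (2 * ((x₀ - y₀) / ℓ) - ((x₀ - y₀) / ℓ) ^ 2)).const_mul a
      exact this.congr_deriv (by ring)
    have h2 := ((hreg.time t₀ ht x₀).hasDerivAt.sub (hreg.time t₀ ht y₀).hasDerivAt).sub h1
    have := hasDerivAt_nonneg_of_max_left ht₀pos ht₀.2 h2 fun s hs => by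
      have := hmax s hs x₀ y₀ hr₀
      simp only [hΨ] at this
      simp only [Pi.sub_apply]
      linarith
    linarith
  have hψ'b : |ψ' (x₀ - y₀)| ≤ 2 * a / ℓ := by
    have h1 : 0 ≤ (x₀ - y₀) / ℓ := div_nonneg hr0.le hℓ.le
    have h2 : (x₀ - y₀) / ℓ ≤ 1 := (div_le_one hℓ).2 hrℓ.le
    have e : ψ' (x₀ - y₀) = 2 * a / ℓ * (1 - (x₀ - y₀) / ℓ) := by
      simp only [hψ']; ring
    have h3 : 0 ≤ 2 * a / ℓ := by positivity
    rw [e, abs_of_nonneg (mul_nonneg h3 (by linarith))]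
    exact mul_le_of_le_one_right h3 (by linarith)
  have hgx : |f' t₀ x₀| ≤ 2 * a / ℓ + 2 * ε := by
    have h1 : |ε * w| ≤ 2 * ε := by rw [abs_mul, abs_of_pos hε]; nlinarith
    rw [abs_le] at *
    constructor <;> linarith
  have hgy : |f' t₀ y₀| ≤ 2 * a / ℓ + 2 * ε := by
    have h1 : |ε * w₂| ≤ 2 * ε := by rw [abs_mul, abs_of_pos hε]; nlinarith
    rw [abs_le] at *
    constructor <;> linarith
  have hix := (abs_le.1 (hineq t₀ ht x₀ hxN)).2
  have hiy := (abs_le.1 (hineq t₀ ht y₀ hyN)).1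
  have hB1 := mul_le_mul_of_nonneg_left hgx hB
  have hB2 := mul_le_mul_of_nonneg_left hgy hB
  have hD1 := mul_le_mul_of_nonneg_left hsec hD.le
  have e1 : D * (8 * a / ℓ ^ 2) = 8 * D * a / ℓ ^ 2 := by ring
  have e2 : B * (2 * a / ℓ) * 2 = 4 * B * a / ℓ := by ring
  linarith

/-- Gradient bound with the parabolic rate `t ^ (-1/2)`. -/
lemma SepRegular.exists_gradient_bound {T : ℝ} {N : Set ℝ} {d W : ℝ → ℝ} {f f' : ℝ → ℝ → ℝ}
    (hreg : SepRegular T N d f f') (hd : LocallyIntegrable d volume) (hd1 : ∀ x, 1 ≤ d x)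
    (hW : IsBarrier N d W) {D B C A : ℝ} (hT : 0 < T) (hD : 0 < D) (hB : 0 ≤ B) (hC : 0 ≤ C)
    (hA : 0 < A) (hbd : ∀ t ∈ Icc 0 T, ∀ x, |f t x| ≤ A)
    (hineq : ∀ t ∈ Ioc 0 T, ∀ x ∉ N,
      |deriv (fun s => f s x) t - D * deriv (f' t) x| ≤ B * |f' t x| + C) :
    ∃ L, 0 ≤ L ∧ ∀ t ∈ Ioc 0 T, ∀ x, |f' t x| ≤ L / √t := by
  set S := 1 + 4 * B * √T + 2 * C * T / (2 * A) with hS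
  have hSpos : 0 < S := by positivity
  set κ := min 1 (4 * D / S) with hκ
  have hκ0 : 0 < κ := by positivity
  have hκ1 : κ ≤ 1 := min_le_left _ _
  have hκS : κ * S ≤ 4 * D := by
    rw [← le_div_iff₀ hSpos]; exact min_le_right _ _
  have hsmall : ∀ τ ∈ Ioc 0 T, 2 * A / τ + 4 * B * (2 * A) / (κ * √τ) + 2 * C
      < 8 * D * (2 * A) / (κ * √τ) ^ 2 := by
    intro τ hτ
    have hs0 : 0 < √τ := Real.sqrt_pos.2 hτ.1
    have hss : √τ ^ 2 = τ := Real.sq_sqrt hτ.1.le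
    have hsT : √τ ≤ √T := Real.sqrt_le_sqrt hτ.2
    rw [lt_div_iff₀ (by positivity), mul_pow, hss]
    have e : (2 * A / τ + 4 * B * (2 * A) / (κ * √τ) + 2 * C) * (κ ^ 2 * τ)
        = 2 * A * κ * (κ + 4 * B * √τ + κ * (2 * C * τ / (2 * A))) := by
      have : τ ≠ 0 := hτ.1.ne'
      field_simp
      linear_combination (-(4 * A * B)) * hss
    rw [e]
    have h1 : κ + 4 * B * √τ + κ * (2 * C * τ / (2 * A)) ≤ S := by
      have h2 : 2 * C * τ / (2 * A) ≤ 2 * C * T / (2 * A) := by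
        have := hτ.2
        gcongr
      have h3 : κ * (2 * C * τ / (2 * A)) ≤ 2 * C * τ / (2 * A) :=
        mul_le_of_le_one_left (div_nonneg (mul_nonneg (by positivity) hτ.1.le) (by positivity)) hκ1
      have h4 : 4 * B * √τ ≤ 4 * B * √T := by gcongr
      linarith
    have h5 : 2 * A * κ * (κ + 4 * B * √τ + κ * (2 * C * τ / (2 * A))) ≤ 2 * A * (κ * S) := by
      rw [mul_assoc]; gcongr
    nlinarith
  have upper : ∀ {g g' : ℝ → ℝ → ℝ}, SepRegular T N d g g' →
      (∀ t ∈ Icc 0 T, ∀ x, |g t x| ≤ A) →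
      (∀ t ∈ Ioc 0 T, ∀ x ∉ N,
        |deriv (fun s => g s x) t - D * deriv (g' t) x| ≤ B * |g' t x| + C) →
      ∀ t ∈ Ioc 0 T, ∀ x, g' t x ≤ 4 * A / κ / √t := by
    intro g g' hg hgA hgi t ht x
    have hs0 : 0 < √t := Real.sqrt_pos.2 ht.1
    have h1 := (hg.space t ht x).hasDerivWithinAt (s := Ioi x)
    rw [hasDerivWithinAt_iff_tendsto_slope' (by simp)] at h1
    refine le_of_tendsto h1 ?_
    filter_upwards [Ioo_mem_nhdsGT (show x < x + κ * √t by
      linarith [mul_pos hκ0 hs0])] with y hy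
    have := hg.osc_le hd hd1 hW (a := 2 * A) (C := C) hD hB (by positivity) (mul_pos hκ0 hs0)
      ht.1 ht.2 (fun s hs x y => by
        have h1 := (abs_le.1 (hgA s hs x)).2
        have h2 := (abs_le.1 (hgA s hs y)).1
        linarith) hgi (hsmall t ht) hy.1 (by linarith [hy.2])
    rw [slope_def_field, div_le_iff₀ (sub_pos.2 hy.1)]
    refine this.trans (le_of_eq ?_)
    field_simp
    ring
  refine ⟨4 * A / κ, by positivity, fun t ht x => abs_le.2 ⟨?_, upper hreg hbd hineq t ht x⟩⟩
  have := upper hreg.neg (fun t ht x => by rw [abs_neg]; exact hbd t ht x)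
    (fun t ht x hx => by
      have h1 : deriv (fun s => -f s x) t = -deriv (fun s => f s x) t := deriv.fun_neg
      have h2 : deriv (fun x => -f' t x) x = -deriv (f' t) x := deriv.fun_neg
      rw [h1, h2, abs_neg, ← abs_neg]
      refine le_trans (le_of_eq ?_) (hineq t ht x hx)
      congr 1; ring) t ht x
  linarith

/-- A separately regular function vanishing initially and satisfying a linear nonlocal
differential inequality with an integrable singularity in time vanishes. -/
lemma SepRegular.eq_zero {T : ℝ} {N : Set ℝ} {d W : ℝ → ℝ} {q q' : ℝ → ℝ → ℝ}
    (hreg : SepRegular T N d q q') (hd : LocallyIntegrable d volume) (hd1 : ∀ x, 1 ≤ d x)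
    (hW : IsBarrier N d W) {D B C A : ℝ} (hD : 0 < D) (hB : 0 ≤ B) (hC : 0 ≤ C)
    (hbd : ∀ t ∈ Icc 0 T, ∀ x, |q t x| ≤ A) (hinit : ∀ x, q 0 x = 0)
    (hineq : ∀ t ∈ Ioc 0 T, ∀ x ∉ N, ∀ m, (∀ y, |q t y| ≤ m) →
      |deriv (fun s => q s x) t - D * deriv (q' t) x| ≤ B * |q' t x| + C * m / √t) :
    ∀ t ∈ Icc 0 T, ∀ x, q t x = 0 := by
  by_contra! hcon
  obtain ⟨t₁, ht₁, x₁, hne⟩ := hcon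
  set k := 4 * C + 4 with hk
  have hkpos : 0 < k := by positivity
  set E : ℝ → ℝ := fun t => Real.exp (-(k * √t)) with hE
  have hEpos : ∀ t, 0 < E t := fun t => Real.exp_pos _
  have hE1 : ∀ t, E t ≤ 1 := fun t => Real.exp_le_one_iff.2 (by
    have := Real.sqrt_nonneg t
    have := mul_nonneg hkpos.le this
    linarith)
  set s : Set ℝ := (fun p : ℝ × ℝ => |q p.1 p.2| * E p.1) '' (Icc 0 T ×ˢ univ) with hs
  have hbdd : BddAbove s := by
    refine ⟨A, ?_⟩
    rintro _ ⟨⟨t, x⟩, ⟨ht, -⟩, rfl⟩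
    exact (mul_le_of_le_one_right (abs_nonneg _) (hE1 t)).trans (hbd t ht x)
  set Q := sSup s with hQ
  have hQle : ∀ t ∈ Icc 0 T, ∀ x, |q t x| * E t ≤ Q := fun t ht x =>
    le_csSup hbdd ⟨(t, x), ⟨ht, trivial⟩, rfl⟩
  have hQpos : 0 < Q :=
    (mul_pos (abs_pos.2 hne) (hEpos t₁)).trans_le (hQle t₁ ht₁ x₁)
  obtain ⟨_, ⟨⟨t₂, x₂⟩, ⟨ht₂, -⟩, rfl⟩, h34⟩ :=
    exists_lt_of_lt_csSup (⟨_, ⟨(t₁, x₁), ⟨ht₁, trivial⟩, rfl⟩⟩ : s.Nonempty)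
      (show 3 / 4 * Q < sSup s by rw [← hQ]; linarith)
  simp only at h34 ht₂
  obtain ⟨f, f', hf, hfabs, hf2, hfineq⟩ : ∃ f f' : ℝ → ℝ → ℝ, SepRegular T N d f f' ∧
      (∀ t x, |f t x| = |q t x|) ∧ f t₂ x₂ = |q t₂ x₂| ∧
      (∀ t ∈ Ioc 0 T, ∀ x ∉ N, ∀ m, (∀ y, |q t y| ≤ m) →
        |deriv (fun s => f s x) t - D * deriv (f' t) x| ≤ B * |f' t x| + C * m / √t) := by
    rcases abs_choice (q t₂ x₂) with h | h
    · exact ⟨q, q', hreg, fun _ _ => rfl, h.symm, hineq⟩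
    · refine ⟨_, _, hreg.neg, fun _ _ => abs_neg _, h.symm, fun t ht x hx m hm => ?_⟩
      have h1 : deriv (fun s => -q s x) t = -deriv (fun s => q s x) t := deriv.fun_neg
      have h2 : deriv (fun x => -q' t x) x = -deriv (q' t) x := deriv.fun_neg
      rw [h1, h2, abs_neg, ← abs_neg]
      refine le_trans (le_of_eq ?_) (hineq t ht x hx m hm)
      congr 1; ring
  rw [← hf2] at h34
  have hfQ : ∀ t ∈ Icc 0 T, ∀ x, f t x * E t ≤ Q := fun t ht x =>
    (mul_le_mul_of_nonneg_right (le_abs_self _) (hEpos t).le).trans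
      (by rw [hfabs]; exact hQle t ht x)
  have hTnn : 0 ≤ T := ht₁.1.trans ht₁.2
  have hWneg : ∀ x, W x ≤ 0 := fun x => (hW.2.1 x).trans (by linarith [abs_nonneg x])
  obtain ⟨ε, hε, hε1, hε2⟩ := exists_pos_mul_lt_and (c₁ := -W x₂) (c₂ := 2 * (D + B) * √T)
    (by linarith [hWneg x₂]) (by positivity) (show 0 < Q / 4 by positivity) hQpos
  set b := 2 * Q / ε + |x₂| with hb
  set Ψ : ℝ × ℝ → ℝ := fun p => f p.1 p.2 * E p.1 + ε * W p.2 with hΨ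
  have hEc : Continuous E := by simp only [hE]; fun_prop
  have hWc := hW.1
  have hΨc : ContinuousOn Ψ (Icc 0 T ×ˢ Icc (-b) b) := by
    refine ContinuousOn.add (ContinuousOn.mul ?_ ?_) ?_
    · exact hf.cont.mono (prod_mono_right (subset_univ _))
    · exact (hEc.comp continuous_fst).continuousOn
    · exact (continuous_const.mul (hWc.comp continuous_snd)).continuousOn
  have hbx : |x₂| ≤ b := by
    have : 0 ≤ 2 * Q / ε := by positivity
    linarith
  have hmem : (t₂, x₂) ∈ Icc 0 T ×ˢ Icc (-b) b := ⟨ht₂, abs_le.1 hbx⟩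
  obtain ⟨⟨t₀, x₀⟩, ⟨ht₀, -⟩, hmaxK⟩ :=
    (isCompact_Icc.prod isCompact_Icc).exists_isMaxOn ⟨_, hmem⟩ hΨc
  simp only at ht₀
  have hpos : Q / 2 < Ψ (t₀, x₀) := by
    refine lt_of_lt_of_le ?_ (hmaxK hmem)
    simp only [hΨ]
    linarith
  have hmax : ∀ t ∈ Icc 0 T, ∀ x, Ψ (t, x) ≤ Ψ (t₀, x₀) := by
    intro t ht x
    by_cases hx : |x| ≤ b
    · exact hmaxK ⟨ht, abs_le.1 hx⟩
    · have h1 := hfQ t ht x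
      have h3 : W x ≤ -(Q / ε) := by
        have h2 := hW.2.1 x
        have : 2 * Q / ε ≤ b := le_add_of_nonneg_right (abs_nonneg _)
        have e : 2 * Q / ε = 2 * (Q / ε) := by ring
        linarith [not_le.1 hx]
      have h4 : ε * W x ≤ -Q := by
        refine (mul_le_mul_of_nonneg_left h3 hε.le).trans (le_of_eq ?_)
        field_simp
      simp only [hΨ] at hpos ⊢
      linarith
  have hf0 : Q / 2 < f t₀ x₀ * E t₀ := by
    have := mul_nonpos_of_nonneg_of_nonpos hε.le (hWneg x₀)
    simp only [hΨ] at hpos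
    linarith
  have ht₀pos : 0 < t₀ := by
    refine lt_of_le_of_ne ht₀.1 fun h => ?_
    have : f t₀ x₀ = 0 := by
      rw [← abs_eq_zero, hfabs, ← h, hinit, abs_zero]
    rw [this] at hf0
    linarith
  have ht : t₀ ∈ Ioc 0 T := ⟨ht₀pos, ht₀.2⟩
  have hmx : IsLocalMax (fun x => f t₀ x * E t₀ + ε * W x) x₀ :=
    Eventually.of_forall fun x => hmax t₀ ht₀ x
  have hdx : ∀ x, HasDerivAt (fun x => f t₀ x * E t₀) (f' t₀ x * E t₀) x := fun x =>
    (hf.space t₀ ht x).mul_const _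
  obtain ⟨hxN, w, hw, hwx, hpar⟩ := hW.touching hd hd1 hε hmx hdx fun hx =>
    ((hf.bad t₀ ht _ hx).const_mul_left (E t₀)).congr_left fun z => by ring
  have hsec := IsBarrier.second_deriv_le hε hmx hdx hpar
    ((hf.space2 t₀ ht _ hxN).hasDerivAt.mul_const (E t₀))
  have hs0 : 0 < √t₀ := Real.sqrt_pos.2 ht₀pos
  have htime : 0 ≤ deriv (fun s => f s x₀) t₀ * E t₀ + f t₀ x₀ * (E t₀ * -(k * (1 / (2 * √t₀)))) :=
    hasDerivAt_nonneg_of_max_left (u := fun s => f s x₀ * E s) ht₀pos ht₀.2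
      ((hf.time t₀ ht x₀).hasDerivAt.mul
        (((Real.hasDerivAt_sqrt ht₀pos.ne').const_mul k).neg.exp)) fun s hs => by
        have := hmax s hs x₀
        simp only [hΨ] at this
        linarith
  have hi := (abs_le.1 (hfineq t₀ ht x₀ hxN (Q / E t₀) fun y => by
    rw [le_div_iff₀ (hEpos _)]; exact hQle t₀ ht₀ y)).2
  have hi' := mul_le_mul_of_nonneg_right hi (hEpos t₀).le
  have hgrad : |f' t₀ x₀| * E t₀ ≤ 2 * ε := by
    have h : |f' t₀ x₀| * E t₀ = |f' t₀ x₀ * E t₀| := by rw [abs_mul, abs_of_pos (hEpos t₀)]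
    rw [h, hwx, abs_neg, abs_mul, abs_of_pos hε]
    nlinarith
  have e1 : (B * |f' t₀ x₀| + C * (Q / E t₀) / √t₀) * E t₀
      = B * (|f' t₀ x₀| * E t₀) + C * Q / √t₀ := by
    have := (hEpos t₀).ne'
    field_simp
  rw [e1] at hi'
  have hB1 := mul_le_mul_of_nonneg_left hgrad hB
  have hD1 := mul_le_mul_of_nonneg_left hsec hD.le
  have h1 : k / 4 * Q / √t₀ ≤ f t₀ x₀ * E t₀ * (k * (1 / (2 * √t₀))) := by
    calc k / 4 * Q / √t₀ = Q / 2 * (k * (1 / (2 * √t₀))) := by field_simp; ring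
      _ ≤ _ := by gcongr
  have h2 : k / 4 * Q / √t₀ = C * Q / √t₀ + Q / √t₀ := by rw [hk]; ring
  have h3 : Q / √t₀ ≤ ε * (2 * (D + B)) := by nlinarith
  rw [div_le_iff₀ hs0] at h3
  have h4 : ε * (2 * (D + B)) * √t₀ ≤ ε * (2 * (D + B)) * √T := by
    have := Real.sqrt_le_sqrt ht₀.2
    gcongr
  nlinarith

/-- The first moment `∫_{x-R}^{x+R} (x-y) h(y) dy` of `h` in the window of radius `R`. -/
noncomputable def localMoment (R : ℝ) (h : ℝ → ℝ) (x : ℝ) : ℝ :=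
  ∫ y in (x - R)..(x + R), (x - y) * h y

/-- The pointwise derivative of `localMoment R h` at points of continuity. -/
noncomputable def localMomentDeriv (R : ℝ) (h : ℝ → ℝ) (x : ℝ) : ℝ :=
  (∫ y in (x - R)..(x + R), h y) - R * (h (x + R) + h (x - R))

lemma IsEvenPeriodicDensity.intervalIntegrable {f : ℝ → ℝ} (hf : IsEvenPeriodicDensity f)
    (a b : ℝ) : IntervalIntegrable f volume a b := by
  obtain ⟨hp, he, -, h1⟩ := hf
  have h01 : IntervalIntegrable f volume 0 1 := by
    by_contra h
    rw [intervalIntegral.integral_undef h] at h1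
    exact zero_ne_one h1
  have h10 : IntervalIntegrable f volume (-1) 0 := by
    have := (IntervalIntegrable.iff_comp_neg (by simp)).1 h01
    simpa [he] using this.symm
  refine Function.Periodic.intervalIntegrable (T := 2) (t := -1) hp (by norm_num) ?_ a b
  have := h10.trans h01
  norm_num
  exact this

lemma locallyIntegrable_of_intervalIntegrable {u : ℝ → ℝ}
    (hu : ∀ a b, IntervalIntegrable u volume a b) : LocallyIntegrable u volume := by
  rw [locallyIntegrable_iff]
  intro K hK
  obtain ⟨r, hr⟩ := hK.isBounded.subset_closedBall 0
  rw [Real.closedBall_eq_Icc] at hr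
  by_cases hr0 : 0 ≤ r
  · exact ((intervalIntegrable_iff_integrableOn_Icc_of_le (by linarith)).1
      (hu (0 - r) (0 + r))).mono_set hr
  · rw [Icc_eq_empty (by linarith), subset_empty_iff] at hr
    simp [hr]

section LocalMoment

variable {R : ℝ} {h : ℝ → ℝ}

lemma intervalIntegrable_id_mul (hi : ∀ a b, IntervalIntegrable h volume a b) (a b : ℝ) :
    IntervalIntegrable (fun y => y * h y) volume a b :=
  (hi a b).continuousOn_mul continuous_id.continuousOn

lemma localMoment_eq (hi : ∀ a b, IntervalIntegrable h volume a b) (x : ℝ) :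
    localMoment R h x = x * ((∫ y in (0:ℝ)..(x + R), h y) - ∫ y in (0:ℝ)..(x - R), h y)
      - ((∫ y in (0:ℝ)..(x + R), y * h y) - ∫ y in (0:ℝ)..(x - R), y * h y) := by
  have hi' := intervalIntegrable_id_mul hi
  rw [intervalIntegral.integral_interval_sub_left (hi _ _) (hi _ _),
    intervalIntegral.integral_interval_sub_left (hi' _ _) (hi' _ _),
    ← intervalIntegral.integral_const_mul,
    ← intervalIntegral.integral_sub ((hi _ _).const_mul x) (hi' _ _), localMoment]
  exact intervalIntegral.integral_congr fun y _ => by ring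

lemma continuous_localMoment (hi : ∀ a b, IntervalIntegrable h volume a b) :
    Continuous (localMoment R h) := by
  have h0 := intervalIntegral.continuous_primitive hi 0
  have h1 := intervalIntegral.continuous_primitive (intervalIntegrable_id_mul hi) 0
  have : localMoment R h = _ := funext (localMoment_eq (R := R) hi)
  rw [this]
  have hp : Continuous fun x : ℝ => x + R := by fun_prop
  have hm : Continuous fun x : ℝ => x - R := by fun_prop
  exact (continuous_id.mul ((h0.comp hp).sub (h0.comp hm))).sub ((h1.comp hp).sub (h1.comp hm))

lemma hasDerivAt_localMoment (hi : ∀ a b, IntervalIntegrable h volume a b) {x : ℝ}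
    (h0p : HasDerivAt (fun z => ∫ y in (0:ℝ)..z, h y) (h (x + R)) (x + R))
    (h0m : HasDerivAt (fun z => ∫ y in (0:ℝ)..z, h y) (h (x - R)) (x - R))
    (h1p : HasDerivAt (fun z => ∫ y in (0:ℝ)..z, y * h y) ((x + R) * h (x + R)) (x + R))
    (h1m : HasDerivAt (fun z => ∫ y in (0:ℝ)..z, y * h y) ((x - R) * h (x - R)) (x - R)) :
    HasDerivAt (localMoment R h) (localMomentDeriv R h x) x := by
  have : localMoment R h = _ := funext (localMoment_eq (R := R) hi)
  rw [this]
  refine (((hasDerivAt_id x).mul ((h0p.comp_add_const x R).sub (h0m.comp_sub_const x R))).sub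
    ((h1p.comp_add_const x R).sub (h1m.comp_sub_const x R))).congr_deriv ?_
  rw [localMomentDeriv, ← intervalIntegral.integral_interval_sub_left (hi 0 _) (hi 0 _)]
  simp only [id, Pi.sub_apply]
  ring

lemma hasDerivAt_localMoment_of_continuous (hc : Continuous h) (x : ℝ) :
    HasDerivAt (localMoment R h) (localMomentDeriv R h x) x := by
  have h1 : Continuous fun y => y * h y := continuous_id.mul hc
  exact hasDerivAt_localMoment (fun a b => hc.intervalIntegrable a b)
    (hc.integral_hasStrictDerivAt _ _).hasDerivAt (hc.integral_hasStrictDerivAt _ _).hasDerivAt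
    (h1.integral_hasStrictDerivAt _ _).hasDerivAt (h1.integral_hasStrictDerivAt _ _).hasDerivAt

lemma ae_differentiableAt_localMoment (hi : ∀ a b, IntervalIntegrable h volume a b) :
    ∀ᵐ x, DifferentiableAt ℝ (localMoment R h) x := by
  have key : ∀ {u : ℝ → ℝ}, (∀ a b, IntervalIntegrable u volume a b) →
      ∀ c, ∀ᵐ x, HasDerivAt (fun z => ∫ y in (0:ℝ)..z, u y) (u (x + c)) (x + c) := by
    intro u hu c
    have := LocallyIntegrable.ae_hasDerivAt_integral (locallyIntegrable_of_intervalIntegrable hu)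
    have h2 := (measurePreserving_add_right volume c).quasiMeasurePreserving.ae this
    filter_upwards [h2] with x hx using hx 0
  have hi' := intervalIntegrable_id_mul hi
  filter_upwards [key hi R, key hi (-R), key hi' R, key hi' (-R)] with x a b c e
  simp only [← sub_eq_add_neg] at b e
  exact (hasDerivAt_localMoment hi a b c e).differentiableAt

lemma localMoment_odd (he : ∀ x, h (-x) = h x) (x : ℝ) :
    localMoment R h (-x) = -localMoment R h x := by
  rw [localMoment, localMoment, ← intervalIntegral.integral_neg,
    show -x - R = -(x + R) by ring, show -x + R = -(x - R) by ring,
    ← intervalIntegral.integral_comp_neg]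
  exact intervalIntegral.integral_congr fun y _ => by simp only [he]; ring

lemma localMoment_periodic (hp : ∀ x, h (x + 2) = h x) (x : ℝ) :
    localMoment R h (x + 2) = localMoment R h x := by
  rw [localMoment, localMoment, show x + 2 - R = x - R + 2 by ring,
    show x + 2 + R = x + R + 2 by ring, ← intervalIntegral.integral_comp_add_right]
  exact intervalIntegral.integral_congr fun y _ => by simp only [hp]; ring

lemma abs_localMoment_le (hR : 0 < R) (hR1 : R ≤ 1) {δ : ℝ} (hδ : ∀ x, |h x| ≤ δ) (x : ℝ) :
    |localMoment R h x| ≤ 2 * δ := by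
  have hδ0 : 0 ≤ δ := (abs_nonneg _).trans (hδ 0)
  have := intervalIntegral.norm_integral_le_of_norm_le_const (a := x - R) (b := x + R)
    (f := fun y => (x - y) * h y) (C := 1 * δ) fun y hy => by
      rw [uIoc_of_le (by linarith)] at hy
      rw [norm_mul]
      refine mul_le_mul ?_ (hδ y) (norm_nonneg _) zero_le_one
      rw [Real.norm_eq_abs, abs_le]
      constructor <;> linarith [hy.1, hy.2]
  rw [show x + R - (x - R) = 2 * R by ring, abs_of_pos (by linarith)] at this
  refine this.trans ?_
  nlinarith

lemma abs_localMomentDeriv_le (hR : 0 < R) (hR1 : R ≤ 1) {δ : ℝ} (hδ : ∀ x, |h x| ≤ δ) (x : ℝ) :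
    |localMomentDeriv R h x| ≤ 4 * δ := by
  have hδ0 : 0 ≤ δ := (abs_nonneg _).trans (hδ 0)
  have := intervalIntegral.norm_integral_le_of_norm_le_const (a := x - R) (b := x + R)
    (f := h) (C := δ) fun y _ => hδ y
  rw [show x + R - (x - R) = 2 * R by ring, abs_of_pos (by linarith), Real.norm_eq_abs] at this
  have h1 := abs_le.1 this
  have h2 := abs_le.1 (hδ (x + R))
  have h3 := abs_le.1 (hδ (x - R))
  rw [localMomentDeriv, abs_le]
  constructor <;> nlinarith

lemma localMoment_sub {u v : ℝ → ℝ} (hu : Continuous u) (hv : Continuous v) (x : ℝ) :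
    localMoment R u x - localMoment R v x = localMoment R (fun y => u y - v y) x := by
  rw [localMoment, localMoment, localMoment, ← intervalIntegral.integral_sub]
  · exact intervalIntegral.integral_congr fun y _ => by ring
  all_goals exact Continuous.intervalIntegrable (by fun_prop) _ _

lemma localMomentDeriv_sub {u v : ℝ → ℝ} (hu : Continuous u) (hv : Continuous v) (x : ℝ) :
    localMomentDeriv R u x - localMomentDeriv R v x
      = localMomentDeriv R (fun y => u y - v y) x := by
  simp only [localMomentDeriv]
  rw [intervalIntegral.integral_sub (hu.intervalIntegrable _ _) (hv.intervalIntegrable _ _)]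
  ring

end LocalMoment

lemma exists_bound_of_periodic {f : ℝ → ℝ} (hc : Continuous f) (hp : ∀ x, f (x + 2) = f x) :
    ∃ A, 0 < A ∧ ∀ x, |f x| ≤ A := by
  obtain ⟨A, hA⟩ := (isCompact_Icc (a := (0:ℝ)) (b := 2)).exists_bound_of_continuousOn
    hc.continuousOn
  refine ⟨max A 1, by positivity, fun x => ?_⟩
  obtain ⟨y, hy, hxy⟩ := Function.Periodic.exists_mem_Ico₀ (f := f) hp (by norm_num) x
  rw [hxy]
  exact (hA y ⟨hy.1, hy.2.le⟩).trans (le_max_left _ _)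

lemma exists_bound_of_periodic_of_continuousOn {T : ℝ} {ρ : ℝ → ℝ → ℝ}
    (hc : ContinuousOn (Function.uncurry ρ) (Icc 0 T ×ˢ univ))
    (hp : ∀ t ∈ Icc 0 T, ∀ x, ρ t (x + 2) = ρ t x) :
    ∃ A, 0 < A ∧ ∀ t ∈ Icc 0 T, ∀ x, |ρ t x| ≤ A := by
  obtain ⟨A, hA⟩ := (isCompact_Icc.prod
    (isCompact_Icc (a := (0:ℝ)) (b := 2))).exists_bound_of_continuousOn
      (hc.mono (prod_mono_right (subset_univ _)))
  refine ⟨max A 1, by positivity, fun t ht x => ?_⟩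
  obtain ⟨y, hy, hxy⟩ := Function.Periodic.exists_mem_Ico₀ (f := ρ t) (hp t ht) (by norm_num) x
  rw [hxy]
  exact (hA (t, y) ⟨ht, hy.1, hy.2.le⟩).trans (le_max_left _ _)

/-- The primitive of an odd periodic function is periodic. -/
lemma periodic_primitive_of_odd {f : ℝ → ℝ} (hc : Continuous f) (hp : ∀ x, f (x + 2) = f x)
    (ho : ∀ x, f (-x) = -f x) (x : ℝ) :
    ∫ y in (0:ℝ)..(x + 2), f y = ∫ y in (0:ℝ)..x, f y := by
  have hi : ∀ a b, IntervalIntegrable f volume a b := fun a b => hc.intervalIntegrable a b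
  rw [← intervalIntegral.integral_add_adjacent_intervals (hi 0 x) (hi x (x + 2)),
    Function.Periodic.intervalIntegral_add_eq (T := 2) hp x (-1)]
  have h1 : ∫ y in (-1:ℝ)..1, f y = ∫ y in (-1:ℝ)..1, f (-y) := by
    rw [intervalIntegral.integral_comp_neg, neg_neg]
  simp only [ho, intervalIntegral.integral_neg] at h1
  rw [show (-1:ℝ) + 2 = 1 by norm_num]
  linarith

lemma Asymptotics.IsBigO.mul_sub_mul {u v w : ℝ → ℝ} {b : ℝ} {l : Filter ℝ} {c : ℝ}
    (hu : (fun y => u y - u b) =O[l] w) (hv : (fun y => v y - v b) =O[l] w)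
    (hvc : Tendsto v l (𝓝 c)) : (fun y => u y * v y - u b * v b) =O[l] w := by
  have h1 : (fun y => (u y - u b) * v y) =O[l] w := by
    simpa using hu.mul (hvc.isBigO_one ℝ)
  exact (h1.add (hv.const_mul_left (u b))).congr_left fun y => by ring

section Weight

variable {R : ℝ} {k : ℝ → ℝ}

/-- A locally integrable weight dominating the increments of `localMoment R k`. -/
def momentWeight (R : ℝ) (k : ℝ → ℝ) (x : ℝ) : ℝ := 1 + (k (x + R) + k (x - R))

lemma momentWeight_intervalIntegrable (hi : ∀ a b, IntervalIntegrable k volume a b) (a b : ℝ) :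
    IntervalIntegrable (momentWeight R k) volume a b := by
  have h1 := (hi (a + R) (b + R)).comp_add_right R
  have h2 := (hi (a - R) (b - R)).comp_sub_right R
  simp only [add_sub_cancel_right, sub_add_cancel] at h1 h2
  exact intervalIntegrable_const.add (h1.add h2)

lemma one_le_momentWeight (hk : ∀ x, 0 ≤ k x) (x : ℝ) : 1 ≤ momentWeight R k x :=
  le_add_of_nonneg_right (add_nonneg (hk _) (hk _))

lemma isBigO_integral_of_le {h d : ℝ → ℝ} {b c : ℝ} (hd : ∀ a b, IntervalIntegrable d volume a b)
    (hle : ∀ s ∈ Ioc b (b + 1), |h s| ≤ c * d s) :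
    (fun y => ∫ s in b..y, h s) =O[𝓝[>] b] fun y => ∫ s in b..y, d s := by
  refine Asymptotics.IsBigO.of_bound |c| ?_
  filter_upwards [Ioo_mem_nhdsGT (show b < b + 1 by linarith)] with y hy
  have := intervalIntegral.norm_integral_le_of_norm_le (f := h) (g := fun s => c * d s)
    (μ := volume) hy.1.le
    (ae_of_all _ fun s hs => hle s ⟨hs.1, hs.2.trans hy.2.le⟩) ((hd b y).const_mul c)
  rw [intervalIntegral.integral_const_mul] at this
  exact this.trans ((le_abs_self _).trans (abs_mul _ _).le)

lemma isBigO_localMoment (hi : ∀ a b, IntervalIntegrable k volume a b) (hk : ∀ x, 0 ≤ k x)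
    (b : ℝ) :
    (fun y => localMoment R k y - localMoment R k b)
      =O[𝓝[>] b] fun y => ∫ s in b..y, momentWeight R k s := by
  have hdi := momentWeight_intervalIntegrable (R := R) hi
  have hd1 : ∀ x, 1 ≤ momentWeight R k x := one_le_momentWeight hk
  have hi' := intervalIntegrable_id_mul hi
  have h0 : ∀ c, (∀ s, k (s + c) ≤ momentWeight R k s) →
      (fun y => (∫ s in (0:ℝ)..(y + c), k s) - ∫ s in (0:ℝ)..(b + c), k s)
        =O[𝓝[>] b] fun y => ∫ s in b..y, momentWeight R k s := by
    intro c hc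
    refine (isBigO_integral_of_le (h := fun s => k (s + c)) (c := 1) hdi fun s _ => ?_).congr_left
      fun y => ?_
    · rw [abs_of_nonneg (hk _), one_mul]; exact hc s
    · rw [intervalIntegral.integral_interval_sub_left (hi _ _) (hi _ _),
        intervalIntegral.integral_comp_add_right]
  have h1 : ∀ c, (∀ s, k (s + c) ≤ momentWeight R k s) →
      (fun y => (∫ s in (0:ℝ)..(y + c), s * k s) - ∫ s in (0:ℝ)..(b + c), s * k s)
        =O[𝓝[>] b] fun y => ∫ s in b..y, momentWeight R k s := by
    intro c hc
    refine (isBigO_integral_of_le (h := fun s => (s + c) * k (s + c)) (c := |b| + 1 + |c|) hdi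
      fun s hs => ?_).congr_left fun y => ?_
    · rw [abs_mul, abs_of_nonneg (hk _)]
      refine mul_le_mul ?_ (hc s) (hk _) (by positivity)
      refine (abs_add_le _ _).trans (add_le_add_left ?_ _)
      rw [abs_le]
      constructor <;> linarith [hs.1, hs.2, neg_abs_le b, le_abs_self b]
    · rw [intervalIntegral.integral_interval_sub_left (hi' _ _) (hi' _ _),
        intervalIntegral.integral_comp_add_right (fun s => s * k s)]
  have hp : ∀ s, k (s + R) ≤ momentWeight R k s := fun s => by
    have := hk (s - R)
    simp only [momentWeight]
    linarith
  have hm : ∀ s, k (s + -R) ≤ momentWeight R k s := fun s => by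
    have := hk (s + R)
    simp only [momentWeight, ← sub_eq_add_neg]
    linarith
  have hc0 := intervalIntegral.continuous_primitive hi 0
  have hprod := Asymptotics.IsBigO.mul_sub_mul (u := fun y => y)
    (v := fun y => (∫ s in (0:ℝ)..(y + R), k s) - ∫ s in (0:ℝ)..(y + -R), k s) (b := b)
    (isBigO_of_differentiableAt (locallyIntegrable_of_intervalIntegrable hdi) hd1
      differentiableAt_id)
    (((h0 R hp).sub (h0 (-R) hm)).congr_left fun y => by ring)
    ((((hc0.comp (continuous_add_const R)).sub
      (hc0.comp (continuous_add_const (-R)))).tendsto b).mono_left nhdsWithin_le_nhds)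
  refine (hprod.sub ((h1 R hp).sub (h1 (-R) hm))).congr_left fun y => ?_
  rw [localMoment_eq hi, localMoment_eq hi]
  simp only [sub_eq_add_neg]
  ring

end Weight

/-- The integrating factor `exp (D⁻¹ ∫₀ˣ Γ)` absorbing the rough drift `Γ`. -/
noncomputable def tilt (D : ℝ) (Γ : ℝ → ℝ) (x : ℝ) : ℝ := Real.exp ((∫ y in (0:ℝ)..x, Γ y) / D)

lemma tilt_pos (D : ℝ) (Γ : ℝ → ℝ) (x : ℝ) : 0 < tilt D Γ x := Real.exp_pos _

lemma hasDerivAt_tilt {D : ℝ} {Γ : ℝ → ℝ} (hΓ : Continuous Γ) (x : ℝ) :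
    HasDerivAt (tilt D Γ) (tilt D Γ x * (Γ x / D)) x :=
  ((hΓ.integral_hasStrictDerivAt 0 x).hasDerivAt.div_const D).exp

lemma continuous_tilt {D : ℝ} {Γ : ℝ → ℝ} (hΓ : Continuous Γ) : Continuous (tilt D Γ) :=
  continuous_iff_continuousAt.2 fun x => (hasDerivAt_tilt hΓ x).continuousAt

lemma exists_tilt_bounds {D : ℝ} {Γ : ℝ → ℝ} (hΓ : Continuous Γ) (hp : ∀ x, Γ (x + 2) = Γ x)
    (ho : ∀ x, Γ (-x) = -Γ x) :
    ∃ e, 0 < e ∧ ∀ x, tilt D Γ x ≤ e ∧ (tilt D Γ x)⁻¹ ≤ e := by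
  have hper : ∀ x, tilt D Γ (x + 2) = tilt D Γ x := fun x => by
    rw [tilt, tilt, periodic_primitive_of_odd hΓ hp ho]
  have hc := continuous_tilt (D := D) hΓ
  obtain ⟨a, ha, h1⟩ := exists_bound_of_periodic hc hper
  obtain ⟨b, hb, h2⟩ := exists_bound_of_periodic (f := fun x => (tilt D Γ x)⁻¹)
    (hc.inv₀ fun x => (tilt_pos D Γ x).ne') fun x => by rw [hper]
  exact ⟨max a b, by positivity, fun x => ⟨((le_abs_self _).trans (h1 x)).trans (le_max_left _ _),
    ((le_abs_self _).trans (h2 x)).trans (le_max_right _ _)⟩⟩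

section Tilted

variable {R M σ T : ℝ} {ρr : ℝ → ℝ} {ρ : ℝ → ℝ → ℝ}

/-- The spatial derivative of `tilt D Γ * ρ`. -/
noncomputable def tiltedDeriv (D : ℝ) (Γ : ℝ → ℝ) (ρ : ℝ → ℝ → ℝ) (t x : ℝ) : ℝ :=
  tilt D Γ x * (deriv (ρ t) x + ρ t x * (Γ x / D))

lemma G_eq_localMoment_add (hi : ∀ a b, IntervalIntegrable (fun y => M * ρr y) volume a b)
    {f : ℝ → ℝ} (hf : Continuous f) (x : ℝ) :
    G R M f ρr x = localMoment R f x + localMoment R (fun y => M * ρr y) x := by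
  rw [G, localMoment, localMoment, ← intervalIntegral.integral_add]
  · exact intervalIntegral.integral_congr fun y _ => by ring
  · exact Continuous.intervalIntegrable (by fun_prop) _ _
  · exact (hi _ _).continuousOn_mul (by fun_prop)

lemma IsClassicalSolutionOn.sepRegular_tilted (hsol : IsClassicalSolutionOn R M σ T ρr ρ)
    (hi : ∀ a b, IntervalIntegrable (fun y => M * ρr y) volume a b)
    (hk : ∀ x, 0 ≤ M * ρr x) (D : ℝ) :
    SepRegular T {x | ¬DifferentiableAt ℝ (localMoment R fun y => M * ρr y) x}
      (momentWeight R fun y => M * ρr y)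
      (fun t x => tilt D (localMoment R fun y => M * ρr y) x * ρ t x)
      (tiltedDeriv D (localMoment R fun y => M * ρr y) ρ) := by
  obtain ⟨hcont, htime, hspace, -⟩ := hsol
  set k := fun y => M * ρr y
  set Γ := localMoment R k
  have hΓ : Continuous Γ := continuous_localMoment hi
  have hE := continuous_tilt (D := D) hΓ
  have hEd : ∀ x, DifferentiableAt ℝ (tilt D Γ) x := fun x => (hasDerivAt_tilt hΓ x).differentiableAt
  have hρd : ∀ t ∈ Ioc 0 T, Differentiable ℝ (ρ t) := fun t ht =>
    (hspace t ht.1 ht.2).differentiable (by norm_num)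
  have hρdd : ∀ t ∈ Ioc 0 T, Differentiable ℝ (deriv (ρ t)) := fun t ht =>
    ((contDiff_succ_iff_deriv (n := 1)).1 (hspace t ht.1 ht.2)).2.2.differentiable (by norm_num)
  refine ⟨?_, fun t ht x => ?_, fun t ht x => ?_, fun t ht x hx => ?_, fun t ht x _ => ?_⟩
  · exact (hE.comp continuous_snd).continuousOn.mul hcont
  · exact ((htime t ht.1 ht.2 x).differentiableAt (by norm_num)).const_mul _
  · refine ((hasDerivAt_tilt hΓ x).mul (hρd t ht x).hasDerivAt).congr_deriv ?_
    rw [tiltedDeriv]; ring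
  · have hx : DifferentiableAt ℝ Γ x := not_not.1 hx
    exact (hEd x).mul ((hρdd t ht x).add ((hρd t ht x).mul (hx.div_const D)))
  · have hd1 : ∀ x, 1 ≤ momentWeight R k x := one_le_momentWeight hk
    have hd := locallyIntegrable_of_intervalIntegrable (momentWeight_intervalIntegrable (R := R) hi)
    have h1 := isBigO_of_differentiableAt hd hd1 ((hEd x).mul (hρdd t ht x))
    have h2 := isBigO_of_differentiableAt hd hd1 (((hEd x).mul (hρd t ht x)).mul_const D⁻¹)
    have h3 := Asymptotics.IsBigO.mul_sub_mul h2 (isBigO_localMoment hi hk x)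
      ((hΓ.tendsto x).mono_left nhdsWithin_le_nhds)
    refine (h1.add h3).congr_left fun y => ?_
    simp only [tiltedDeriv, Pi.mul_apply, Γ]
    ring

lemma IsClassicalSolutionOn.tilted_equation (hsol : IsClassicalSolutionOn R M σ T ρr ρ)
    (hσ : 0 < σ) (hi : ∀ a b, IntervalIntegrable (fun y => M * ρr y) volume a b)
    {t x : ℝ} (ht : t ∈ Ioc 0 T)
    (hx : DifferentiableAt ℝ (localMoment R fun y => M * ρr y) x) :
    deriv (fun s => tilt (σ ^ 2 / 2) (localMoment R fun y => M * ρr y) x * ρ s x) t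
      - σ ^ 2 / 2 * deriv (tiltedDeriv (σ ^ 2 / 2) (localMoment R fun y => M * ρr y) ρ t) x
      = (localMoment R (ρ t) x - localMoment R (fun y => M * ρr y) x)
          * tiltedDeriv (σ ^ 2 / 2) (localMoment R fun y => M * ρr y) ρ t x
        + (localMomentDeriv R (ρ t) x
          - localMoment R (ρ t) x * (localMoment R (fun y => M * ρr y) x / (σ ^ 2 / 2)))
          * (tilt (σ ^ 2 / 2) (localMoment R fun y => M * ρr y) x * ρ t x) := by
  obtain ⟨-, htime, hspace, heq⟩ := hsol
  have hD : σ ^ 2 / 2 ≠ 0 := by positivity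
  have hΓ : Continuous (localMoment R fun y => M * ρr y) := continuous_localMoment hi
  have hc : Continuous (ρ t) := (hspace t ht.1 ht.2).continuous
  have hρ : HasDerivAt (ρ t) (deriv (ρ t) x) x :=
    ((hspace t ht.1 ht.2).differentiable (by norm_num) x).hasDerivAt
  have hρ' : HasDerivAt (deriv (ρ t)) (deriv (deriv (ρ t)) x) x :=
    (((contDiff_succ_iff_deriv (n := 1)).1 (hspace t ht.1 ht.2)).2.2.differentiable
      (by norm_num) x).hasDerivAt
  have hG : G R M (ρ t) ρr = fun y => localMoment R (ρ t) y + localMoment R (fun y => M * ρr y) y :=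
    funext (G_eq_localMoment_add hi hc)
  have h1 := hρ.mul ((hasDerivAt_localMoment_of_continuous (R := R) hc x).add hx.hasDerivAt)
  have h1' : deriv (fun y => ρ t y * G R M (ρ t) ρr y) x = _ :=
    (congrArg (fun u => deriv (fun y => ρ t y * u y) x) hG).trans h1.deriv
  have h2 := (hasDerivAt_tilt (D := σ ^ 2 / 2) hΓ x).mul
    (hρ'.add (hρ.mul (hx.hasDerivAt.div_const (σ ^ 2 / 2))))
  have h2' : deriv (tiltedDeriv (σ ^ 2 / 2) (localMoment R fun y => M * ρr y) ρ t) x = _ := h2.deriv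
  have h3 : deriv (fun s => tilt (σ ^ 2 / 2) (localMoment R fun y => M * ρr y) x * ρ s x) t = _ :=
    (((htime t ht.1 ht.2 x).differentiableAt (by norm_num)).hasDerivAt.const_mul _).deriv
  rw [h3, h2', heq t ht.1 ht.2 x, h1', tiltedDeriv]
  simp only [Pi.add_apply, Pi.mul_apply]
  field_simp
  ring

end Tilted

end

theorem stmt_3 (R M σ T : ℝ) (hR : 0 < R) (hR1 : R ≤ 1) (hM : 0 ≤ M)
    (hσ : 0 < σ) (hT : 0 < T)
    (ρr : ℝ → ℝ) (hρr : IsEvenPeriodicDensity ρr)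
    (ρ₁ ρ₂ : ℝ → ℝ → ℝ)
    (hsol₁ : IsClassicalSolutionOn R M σ T ρr ρ₁)
    (hsol₂ : IsClassicalSolutionOn R M σ T ρr ρ₂)
    (hper₁ : ∀ t ∈ Set.Icc (0:ℝ) T, ∀ x : ℝ, ρ₁ t (x + 2) = ρ₁ t x)
    (hper₂ : ∀ t ∈ Set.Icc (0:ℝ) T, ∀ x : ℝ, ρ₂ t (x + 2) = ρ₂ t x)
    (hdens₁ : ∀ t ∈ Set.Icc (0:ℝ) T,
      (∀ x, 0 ≤ ρ₁ t x) ∧ (∫ x in (0:ℝ)..1, ρ₁ t x) = 1)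
    (hdens₂ : ∀ t ∈ Set.Icc (0:ℝ) T,
      (∀ x, 0 ≤ ρ₂ t x) ∧ (∫ x in (0:ℝ)..1, ρ₂ t x) = 1)
    (hinit : ∀ x : ℝ, ρ₁ 0 x = ρ₂ 0 x) :
    ∀ t ∈ Set.Icc (0:ℝ) T, ∀ x : ℝ, ρ₁ t x = ρ₂ t x := by
  set k : ℝ → ℝ := fun y => M * ρr y with hk
  set Γ := localMoment R k with hΓdef
  set D := σ ^ 2 / 2 with hD
  have hDpos : 0 < D := by positivity
  have hi : ∀ a b, IntervalIntegrable k volume a b := fun a b =>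
    (hρr.intervalIntegrable a b).const_mul M
  obtain ⟨hrp, hre, hr0, -⟩ := hρr
  have hk0 : ∀ x, 0 ≤ k x := fun x => mul_nonneg hM (hr0 x)
  have hΓ : Continuous Γ := continuous_localMoment hi
  have hΓp : ∀ x, Γ (x + 2) = Γ x := localMoment_periodic fun x => by simp only [hk, hrp]
  have hΓo : ∀ x, Γ (-x) = -Γ x := localMoment_odd fun x => by simp only [hk, hre]
  obtain ⟨Γ₀, hΓ₀, hΓle⟩ := exists_bound_of_periodic hΓ hΓp
  obtain ⟨e, he, hEe⟩ := exists_tilt_bounds (D := D) hΓ hΓp hΓo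
  obtain ⟨A₁, hA₁, hρ₁⟩ := exists_bound_of_periodic_of_continuousOn hsol₁.1 hper₁
  obtain ⟨A₂, hA₂, hρ₂⟩ := exists_bound_of_periodic_of_continuousOn hsol₂.1 hper₂
  have hd := locallyIntegrable_of_intervalIntegrable (momentWeight_intervalIntegrable (R := R) hi)
  have hd1 : ∀ x, 1 ≤ momentWeight R k x := one_le_momentWeight hk0
  obtain ⟨W, hW⟩ := exists_isBarrier hd hd1 (N := {x | ¬DifferentiableAt ℝ Γ x})
    (ae_iff.1 (ae_differentiableAt_localMoment hi))
  have hreg₁ := hsol₁.sepRegular_tilted hi hk0 D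
  have hreg₂ := hsol₂.sepRegular_tilted hi hk0 D
  set p₁' := tiltedDeriv D Γ ρ₁ with hp₁'
  set p₂' := tiltedDeriv D Γ ρ₂ with hp₂'
  have hE0 : ∀ x, 0 < tilt D Γ x := tilt_pos D Γ
  have htilt : ∀ {a c : ℝ} x, |a| ≤ c → |tilt D Γ x * a| ≤ e * c := fun {a c} x h => by
    rw [abs_mul, abs_of_pos (hE0 x)]
    exact mul_le_mul (hEe x).1 h (abs_nonneg _) he.le
  have hc₁ : ∀ t ∈ Set.Ioc 0 T, Continuous (ρ₁ t) := fun t ht =>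
    (hsol₁.2.2.1 t ht.1 ht.2).continuous
  have hc₂ : ∀ t ∈ Set.Ioc 0 T, Continuous (ρ₂ t) := fun t ht =>
    (hsol₂.2.2.1 t ht.1 ht.2).continuous
  -- coefficient bounds
  have hpot : ∀ {a b δ : ℝ} (x : ℝ), |a| ≤ 4 * δ → |b| ≤ 2 * δ →
      |a - b * (Γ x / D)| ≤ (4 + 2 * (Γ₀ / D)) * δ := fun {a b δ} x ha hb => by
    have h1 : |b * (Γ x / D)| ≤ 2 * δ * (Γ₀ / D) := by
      rw [abs_mul, abs_div, abs_of_pos hDpos]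
      have := hΓle x
      have := (abs_nonneg _).trans hb
      gcongr
    calc |a - b * (Γ x / D)| ≤ |a| + |b * (Γ x / D)| := abs_sub _ _
      _ ≤ _ := by linarith
  have hdrift : ∀ {a δ : ℝ} (x : ℝ), |a| ≤ 2 * δ → |a - Γ x| ≤ 2 * δ + Γ₀ := fun {a δ} x ha =>
    (abs_sub _ _).trans (add_le_add ha (hΓle x))
  obtain ⟨L, hL, hgrad⟩ := hreg₂.exists_gradient_bound hd hd1 hW hT hDpos (B := 2 * A₂ + Γ₀)
    (C := (4 + 2 * (Γ₀ / D)) * A₂ * (e * A₂)) (A := e * A₂) (by positivity) (by positivity)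
    (by positivity) (fun t ht x => htilt x (hρ₂ t ht x)) fun t ht x hx => by
      have ht' := Set.Ioc_subset_Icc_self ht
      rw [hsol₂.tilted_equation hσ hi ht (not_not.1 hx)]
      refine (abs_add_le _ _).trans ?_
      rw [abs_mul, abs_mul]
      refine add_le_add (mul_le_mul_of_nonneg_right ?_ (abs_nonneg _))
        (mul_le_mul ?_ (htilt x (hρ₂ t ht' x)) (abs_nonneg _) (by positivity))
      · exact hdrift x (abs_localMoment_le hR hR1 (hρ₂ t ht') x)
      · exact hpot x (abs_localMomentDeriv_le hR hR1 (hρ₂ t ht') x)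
          (abs_localMoment_le hR hR1 (hρ₂ t ht') x)
  set P := 4 + 2 * (Γ₀ / D) with hP
  have hP0 : 0 < P := by positivity
  have hzero := (hreg₁.sub hreg₂).eq_zero hd hd1 hW hDpos (B := 2 * A₁ + Γ₀)
    (C := 2 * e * L + (P * A₁ + P * e * (e * A₂)) * √T) (A := e * A₁ + e * A₂) (by positivity)
    (by positivity) (fun t ht x => (abs_sub _ _).trans
      (add_le_add (htilt x (hρ₁ t ht x)) (htilt x (hρ₂ t ht x))))
    (fun x => by rw [hinit, sub_self]) fun t ht x hx m hm => by
      have ht' := Set.Ioc_subset_Icc_self ht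
      have hs0 : 0 < √t := Real.sqrt_pos.2 ht.1
      have hm0 : 0 ≤ m := (abs_nonneg _).trans (hm 0)
      have hx' : DifferentiableAt ℝ Γ x := not_not.1 hx
      have hδ : ∀ y, |ρ₁ t y - ρ₂ t y| ≤ e * m := fun y => by
        have h := hm y
        rw [← mul_sub, abs_mul, abs_of_pos (hE0 y)] at h
        calc |ρ₁ t y - ρ₂ t y| = (tilt D Γ y)⁻¹ * (tilt D Γ y * |ρ₁ t y - ρ₂ t y|) := by
              rw [inv_mul_cancel_left₀ (hE0 y).ne']
          _ ≤ e * m := mul_le_mul (hEe y).2 h (mul_nonneg (hE0 y).le (abs_nonneg _)) he.le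
      have hg := localMoment_sub (R := R) (hc₁ t ht) (hc₂ t ht) x
      have hg' := localMomentDeriv_sub (R := R) (hc₁ t ht) (hc₂ t ht) x
      have e₁ := hsol₁.tilted_equation hσ hi ht hx'
      have e₂ := hsol₂.tilted_equation hσ hi ht hx'
      have hdt : deriv (fun s => tilt D Γ x * ρ₁ s x - tilt D Γ x * ρ₂ s x) t = _ :=
        deriv_fun_sub (hreg₁.time t ht x) (hreg₂.time t ht x)
      have hdx : deriv (fun x => p₁' t x - p₂' t x) x = _ :=
        deriv_fun_sub (hreg₁.space2 t ht x hx) (hreg₂.space2 t ht x hx)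
      have key : deriv (fun s => tilt D Γ x * ρ₁ s x - tilt D Γ x * ρ₂ s x) t
          - D * deriv (fun x => p₁' t x - p₂' t x) x
          = (localMoment R (ρ₁ t) x - Γ x) * (p₁' t x - p₂' t x)
            + localMoment R (fun y => ρ₁ t y - ρ₂ t y) x * p₂' t x
            + (localMomentDeriv R (ρ₁ t) x - localMoment R (ρ₁ t) x * (Γ x / D))
              * (tilt D Γ x * ρ₁ t x - tilt D Γ x * ρ₂ t x)
            + (localMomentDeriv R (fun y => ρ₁ t y - ρ₂ t y) x
              - localMoment R (fun y => ρ₁ t y - ρ₂ t y) x * (Γ x / D))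
              * (tilt D Γ x * ρ₂ t x) := by
        rw [hdt, hdx, ← hg, ← hg']
        linear_combination e₁ - e₂
      have b₁ := mul_le_mul_of_nonneg_right (hdrift x (abs_localMoment_le hR hR1 (hρ₁ t ht') x))
        (abs_nonneg (p₁' t x - p₂' t x))
      have b₂ := mul_le_mul (abs_localMoment_le hR hR1 hδ x) (hgrad t ht x) (abs_nonneg _)
        (by positivity)
      have b₃ := mul_le_mul (hpot x (abs_localMomentDeriv_le hR hR1 (hρ₁ t ht') x)
        (abs_localMoment_le hR hR1 (hρ₁ t ht') x)) (hm x) (abs_nonneg _) (by positivity)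
      have b₄ := mul_le_mul (hpot x (abs_localMomentDeriv_le hR hR1 hδ x)
        (abs_localMoment_le hR hR1 hδ x)) (htilt x (hρ₂ t ht' x)) (abs_nonneg _) (by positivity)
      rw [← abs_mul] at b₁ b₂ b₃ b₄
      refine (congrArg abs key).le.trans ?_
      refine (abs_add_le _ _).trans ((add_le_add ((abs_add_le _ _).trans (add_le_add
        ((abs_add_le _ _).trans (add_le_add b₁ b₂)) b₃)) b₄).trans ?_)
      have hroot : m ≤ √T * m / √t := by
        rw [le_div_iff₀ hs0, mul_comm]
        exact mul_le_mul_of_nonneg_right (Real.sqrt_le_sqrt ht.2) hm0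
      have hlast := mul_le_mul_of_nonneg_left hroot
        (show 0 ≤ P * A₁ + P * e * (e * A₂) by positivity)
      calc _ = (2 * A₁ + Γ₀) * |p₁' t x - p₂' t x| + 2 * e * L * m / √t
            + (P * A₁ + P * e * (e * A₂)) * m := by ring
        _ ≤ (2 * A₁ + Γ₀) * |p₁' t x - p₂' t x| + 2 * e * L * m / √t
            + (P * A₁ + P * e * (e * A₂)) * (√T * m / √t) := by gcongr
        _ = _ := by ring
  intro t ht x
  have := hzero t ht x
  rw [← mul_sub] at this
  exact sub_eq_zero.1 ((mul_eq_zero.1 this).resolve_left (hE0 x).ne')
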